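/- arXiv:1007.1359 — 3 statements merged into one kernel-verified Lean document; each statement's English description precedes it below -/
import Mathlib

section
/- Let Φ be the time-T flow of a Hamiltonian equation ż = JAz + J∇h(z) satisfying assumptions (H1), (H2), (H3). For each ε > 0 and R > 0 there exists N ∈ ℕ such that on the ball B_R(Z) one has the factorization Φ = e^{TJA}(I + Φ̃_ε)(I + Φ̃_N), where (I + Φ̃_ε) and (I + Φ̃_N) are symplectic diffeomorphisms, ‖Φ̃_ε(u)‖_Z ≤ ε for all u ∈ (I + Φ̃_N)(B_R(Z)), and (I + Φ̃_N)(u^N + u_N) = (I + Φ̃_N)(u^N) + u_N for all u^N ∈ Z^N and u_N ∈ Z_N. -/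
open scoped RealInnerProductSpace BigOperators ENNReal NNReal
open Metric

noncomputable section

namespace Kuksin

variable {Z : Type*} [NormedAddCommGroup Z] [InnerProductSpace ℝ Z] [CompleteSpace Z]

/-- The family `b (j, true) = φ_j^+`, `b (j, false) = φ_j^-` (indexed by `j : ℕ`,
standing for `j ≥ 1`) is a Hilbert basis of `Z`. -/
def IsHilbertBasis (b : ℕ × Bool → Z) : Prop :=
  Orthonormal ℝ b ∧ (Submodule.span ℝ (Set.range b)).topologicalClosure = ⊤

/-- The operator `J` acts by `J φ_j^± = ∓ φ_j^∓`. -/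
def IsJ (b : ℕ × Bool → Z) (J : Z →L[ℝ] Z) : Prop :=
  ∀ j : ℕ, J (b (j, true)) = - b (j, false) ∧ J (b (j, false)) = b (j, true)

/-- The orthogonal projector `Π^n` onto `Z^n = span {φ_j^± : j < n}`. -/
def proj (b : ℕ × Bool → Z) (n : ℕ) (z : Z) : Z :=
  ∑ j ∈ Finset.range n, (⟪b (j, true), z⟫ • b (j, true) + ⟪b (j, false), z⟫ • b (j, false))

/-- A (global-in-time) trajectory of the Hamiltonian vector field `X_{f_n} = J ∇ f_n` of
`f_n = f|_{O ∩ Z^n}` on `O^n = O ∩ Z^n`  (the gradient of the restriction of `f` to `Z^n`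
is `Π^n ∇f`). -/
def IsTrajectory (b : ℕ × Bool → Z) (J : Z →L[ℝ] Z) (O : Set Z) (f : Z → ℝ) (n : ℕ)
    (z : ℝ → Z) : Prop :=
  (∀ t : ℝ, z t ∈ O) ∧ (∀ t : ℝ, proj b n (z t) = z t) ∧
  (∀ t : ℝ, HasDerivAt z (J (proj b n (gradient f (z t)))) t)

/-- A fast trajectory: a nonconstant periodic trajectory of period `≤ 1`. -/
def IsFastTrajectory (b : ℕ × Bool → Z) (J : Z →L[ℝ] Z) (O : Set Z) (f : Z → ℝ) (n : ℕ)
    (z : ℝ → Z) : Prop :=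
  IsTrajectory b J O f n z ∧ (∃ t₁ t₂ : ℝ, z t₁ ≠ z t₂) ∧
  (∃ T : ℝ, 0 < T ∧ T ≤ 1 ∧ ∀ t : ℝ, z (t + T) = z t)

/-- `f` is an `m`-admissible function on the open set `O`. -/
def IsAdmissible (O : Set Z) (m : ℝ) (f : Z → ℝ) : Prop :=
  0 < m ∧ ContDiffOn ℝ (⊤ : ℕ∞) f O ∧ (∀ z ∈ O, 0 ≤ f z ∧ f z ≤ m) ∧
  (∃ U : Set Z, IsOpen U ∧ U.Nonempty ∧ U ⊆ O ∧ ∀ z ∈ U, f z = 0) ∧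
  (∀ z ∈ frontier O, f z = m) ∧
  Bornology.IsBounded {z ∈ O | f z < m} ∧
  (∃ d : ℝ, 0 < d ∧ ∀ x ∈ {z ∈ O | f z < m}, ∀ y ∈ frontier O, d ≤ dist x y)

/-- An `m`-admissible function `f` is fast if for all large enough `n` the Hamiltonian
vector field `X_{f_n}` has a fast trajectory. -/
def IsFastFunction (b : ℕ × Bool → Z) (J : Z →L[ℝ] Z) (O : Set Z) (f : Z → ℝ) : Prop :=
  ∃ n₀ : ℕ, ∀ n ≥ n₀, ∃ z : ℝ → Z, IsFastTrajectory b J O f n z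

/-- The set of thresholds `m*` such that every `m`-admissible function with `m > m*` is fast. -/
def capSet (b : ℕ × Bool → Z) (J : Z →L[ℝ] Z) (O : Set Z) : Set ℝ :=
  {m' | 0 ≤ m' ∧ ∀ m : ℝ, ∀ f : Z → ℝ, m' < m → IsAdmissible O m f → IsFastFunction b J O f}

/-- Kuksin's symplectic capacity of an open set `O ⊆ Z` (with value in `[0, ∞]`). -/
def cap (b : ℕ × Bool → Z) (J : Z →L[ℝ] Z) (O : Set Z) : ℝ≥0∞ :=
  sInf (ENNReal.ofReal '' capSet b J O)


/-- `G : Z → Z` is a symplectic diffeomorphism: a bijective `C¹` map with `C¹` inverse whose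
differential preserves the symplectic form `ω(ξ, η) = ⟪Jξ, η⟫`. -/
def IsSymplecticDiffeo {Z : Type*} [NormedAddCommGroup Z] [InnerProductSpace ℝ Z]
    [CompleteSpace Z] (J : Z →L[ℝ] Z) (G : Z → Z) : Prop :=
  Function.Bijective G ∧ ContDiff ℝ 1 G ∧ ContDiff ℝ 1 (Function.invFun G) ∧
  ∀ z ξ η : Z, ⟪J (fderiv ℝ G z ξ), fderiv ℝ G z η⟫ = ⟪J ξ, η⟫

set_option linter.unusedSectionVars false

/-- Symplectic diffeomorphisms with an explicit inverse. -/
def SD (J : Z →L[ℝ] Z) (G : Z → Z) : Prop :=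
  ∃ G' : Z → Z, (∀ x, G' (G x) = x) ∧ (∀ x, G (G' x) = x) ∧ ContDiff ℝ 1 G ∧ ContDiff ℝ 1 G' ∧
    ∀ z ξ η : Z, ⟪J (fderiv ℝ G z ξ), fderiv ℝ G z η⟫ = ⟪J ξ, η⟫

lemma SD.isSymplecticDiffeo {J : Z →L[ℝ] Z} {G : Z → Z} (hG : SD J G) :
    IsSymplecticDiffeo J G := by
  obtain ⟨G', h1, h2, h3, h4, h5⟩ := hG
  have hinj : Function.Injective G := fun x y hxy => by rw [← h1 x, ← h1 y, hxy]
  refine ⟨⟨hinj, fun y => ⟨G' y, h2 y⟩⟩, h3, ?_, h5⟩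
  have : Function.invFun G = G' := by
    funext y
    apply hinj
    rw [h2, Function.invFun_eq ⟨G' y, h2 y⟩]
  rw [this]; exact h4

lemma SD.comp {J : Z →L[ℝ] Z} {F G : Z → Z} (hF : SD J F) (hG : SD J G) :
    SD J (fun x => F (G x)) := by
  obtain ⟨F', f1, f2, f3, f4, f5⟩ := hF
  obtain ⟨G', h1, h2, h3, h4, h5⟩ := hG
  refine ⟨fun x => G' (F' x), fun x => by simp [f1, h1], fun x => by simp [f2, h2],
    f3.comp h3, h4.comp f4, fun z ξ η => ?_⟩
  have : fderiv ℝ (fun x => F (G x)) z = (fderiv ℝ F (G z)).comp (fderiv ℝ G z) :=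
    fderiv_comp z (f3.differentiable one_ne_zero _) (h3.differentiable one_ne_zero _)
  rw [this]
  simp [f5, h5]

lemma SD.symm {J : Z →L[ℝ] Z} {G : Z → Z} (hG : SD J G) :
    ∃ G' : Z → Z, SD J G' ∧ (∀ x, G' (G x) = x) ∧ (∀ x, G (G' x) = x) := by
  obtain ⟨G', h1, h2, h3, h4, h5⟩ := hG
  refine ⟨G', ⟨G, h2, h1, h4, h3, fun z ξ η => ?_⟩, h1, h2⟩
  have key : (fderiv ℝ G (G' z)).comp (fderiv ℝ G' z) = ContinuousLinearMap.id ℝ Z := by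
    rw [← fderiv_comp z (h3.differentiable one_ne_zero _) (h4.differentiable one_ne_zero _)]
    have : G ∘ G' = id := funext h2
    rw [this, fderiv_id]
  have k2 : ∀ ξ, fderiv ℝ G (G' z) (fderiv ℝ G' z ξ) = ξ := fun ξ => by
    have := congrArg (fun L : Z →L[ℝ] Z => L ξ) key
    simpa using this
  rw [← h5 (G' z), k2, k2]

lemma SD.id (J : Z →L[ℝ] Z) : SD J (fun x => x) :=
  ⟨fun x => x, fun _ => rfl, fun _ => rfl, contDiff_id, contDiff_id, fun z ξ η => by simp⟩

lemma SD.add_const {J : Z →L[ℝ] Z} {G : Z → Z} (hG : SD J G) (c : Z) :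
    SD J (fun x => G x + c) := by
  obtain ⟨G', h1, h2, h3, h4, h5⟩ := hG
  refine ⟨fun x => G' (x - c), fun x => by simp [h1], fun x => by simp [h2],
    h3.add contDiff_const, h4.comp (contDiff_id.sub contDiff_const), fun z ξ η => ?_⟩
  rw [fderiv_add_const, h5]

/-- maps of the form `I +` (function of `P x` with values in the range of `P`). -/
def QF (P : Z →L[ℝ] Z) (G : Z → Z) : Prop :=
  (∀ x c, P c = 0 → G (x + c) = G x + c) ∧ (∀ x, P (G x - x) = G x - x)

lemma QF.comp {P : Z →L[ℝ] Z} {F G : Z → Z} (hF : QF P F) (hG : QF P G) :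
    QF P (fun x => F (G x)) := by
  refine ⟨fun x c hc => by simp only [hG.1 x c hc, hF.1 _ c hc], fun x => ?_⟩
  have : F (G x) - x = (F (G x) - G x) + (G x - x) := by abel
  simp only [this, map_add, hF.2, hG.2]

lemma QF.mem {P : Z →L[ℝ] Z} {G : Z → Z} (hG : QF P G) {x : Z} (hx : P x = x) :
    P (G x) = G x := by
  have h := hG.2 x
  rw [map_sub, hx] at h
  exact sub_left_inj.mp h

/-- small Lipschitz perturbations of the identity are diffeomorphisms -/
lemma near_id_diffeo {k : Z → Z} (hk : ContDiff ℝ 1 k) {c : ℝ≥0} (hc : c < 1)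
    (hL : LipschitzWith c k) :
    ∃ S : Z → Z, ContDiff ℝ 1 S ∧ (∀ x, S (x + k x) = x) ∧ (∀ x, S x + k (S x) = x) := by
  have hd : ∀ x, ‖fderiv ℝ k x‖ ≤ c := fun x => norm_fderiv_le_of_lipschitz ℝ hL
  have hu : ∀ x, IsUnit ((1 : Z →L[ℝ] Z) + fderiv ℝ k x) := fun x => by
    have : ‖-fderiv ℝ k x‖ < 1 := by rw [norm_neg]; exact lt_of_le_of_lt (hd x) (by exact_mod_cast hc)
    have h2 := (Units.oneSub _ this).isUnit
    simpa using h2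
  by_cases hZ : Subsingleton Z
  · exact ⟨fun x => x, contDiff_id, fun x => Subsingleton.elim _ _, fun x => Subsingleton.elim _ _⟩
  rw [not_subsingleton_iff_nontrivial] at hZ
  have happ : ApproximatesLinearOn (fun x => x + k x)
      ((ContinuousLinearEquiv.refl ℝ Z : Z ≃L[ℝ] Z) : Z →L[ℝ] Z) Set.univ c := by
    intro x _ y _
    have := hL.norm_sub_le x y
    simpa [add_sub_add_comm] using this
  let H := happ.toHomeomorph _ (Or.inr (by
    have : ‖((ContinuousLinearEquiv.refl ℝ Z).symm : Z →L[ℝ] Z)‖₊ = 1 := by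
      simp
    rw [this]; simpa using hc))
  have hH : ∀ x, H x = x + k x := fun x => rfl
  refine ⟨H.symm, ?_, fun x => ?_, fun x => ?_⟩
  · refine H.contDiff_symm (f₀' := fun x => ContinuousLinearEquiv.ofUnit (hu x).unit) ?_ ?_
    · intro a
      have h1 : HasFDerivAt (fun x => x + k x) (ContinuousLinearMap.id ℝ Z + fderiv ℝ k a) a :=
        (hasFDerivAt_id a).add (hk.differentiable one_ne_zero a).hasFDerivAt
      exact h1
    · exact contDiff_id.add hk
  · rw [← hH, H.symm_apply_apply]
  · rw [← hH, H.apply_symm_apply]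

lemma cayley (J : Z →L[ℝ] Z) (hJ2 : ∀ x, J (J x) = -x) (hJs : ∀ x y, ⟪J x, y⟫ = -⟪x, J y⟫)
    {g : Z → Z} (hg : ContDiff ℝ 1 g) (hsym : ∀ z ξ η, ⟪fderiv ℝ g z ξ, η⟫ = ⟪ξ, fderiv ℝ g z η⟫)
    {c : ℝ≥0} (hc : c ≤ 1) (hL : LipschitzWith c g) (P : Z →L[ℝ] Z)
    (hP1 : ∀ x c, P c = 0 → g (x + c) = g x) (hP2 : ∀ x, P (J (g x)) = J (g x)) :
    ∃ G : Z → Z, SD J G ∧ QF P G ∧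
      ∀ w, ∃ m, w = m - (1/2 : ℝ) • J (g m) ∧ G w = m + (1/2 : ℝ) • J (g m) := by
  have hJn : ∀ x, ‖J x‖ = ‖x‖ := fun x => by
    have h1 : ‖J x‖ ^ 2 = ‖x‖ ^ 2 := by
      rw [← real_inner_self_eq_norm_sq, hJs, hJ2, inner_neg_right, neg_neg,
        real_inner_self_eq_norm_sq]
    exact (sq_eq_sq₀ (norm_nonneg _) (norm_nonneg _)).1 h1
  have hLip : ∀ a : ℝ, |a| = 1/2 → LipschitzWith (1/2) (fun x => a • J (g x)) := by
    intro a ha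
    refine LipschitzWith.of_dist_le_mul fun x y => ?_
    rw [dist_eq_norm, dist_eq_norm, ← smul_sub, ← map_sub, norm_smul, hJn, Real.norm_eq_abs, ha]
    have := hL.norm_sub_le x y
    have h1 : (c : ℝ) * ‖x - y‖ ≤ 1 * ‖x - y‖ := by gcongr; exact_mod_cast hc
    push_cast
    linarith
  have hsm : ∀ a : ℝ, ContDiff ℝ 1 (fun x => a • J (g x)) := fun a =>
    contDiff_const.smul (J.contDiff.comp hg)
  have h12 : (1/2 : ℝ≥0) < 1 := by norm_num
  have hcomm : ∀ a : ℝ, ∀ z ξ, fderiv ℝ (fun x => x + a • J (g x)) z ξ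
      = ξ + a • J (fderiv ℝ g z ξ) := by
    intro a z ξ
    have h1 : HasFDerivAt (fun x => x + a • J (g x))
      (ContinuousLinearMap.id ℝ Z + a • J.comp (fderiv ℝ g z)) z :=
      (hasFDerivAt_id z).add
        ((J.hasFDerivAt.comp z (hg.differentiable one_ne_zero z).hasFDerivAt).const_smul a)
    rw [h1.fderiv]; simp
  have hom : ∀ a : ℝ, ∀ z ξ η, ⟪J (fderiv ℝ (fun x => x + a • J (g x)) z ξ),
      fderiv ℝ (fun x => x + a • J (g x)) z η⟫ =
      ⟪J ξ, η⟫ + a ^ 2 * ⟪J (fderiv ℝ g z ξ), fderiv ℝ g z η⟫ := by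
    intro a z ξ η
    rw [hcomm, hcomm]
    simp only [map_add, map_smul, inner_add_left, inner_add_right, inner_smul_left,
      inner_smul_right, hJ2, inner_neg_left, hsym]
    have e1 : ⟪J ξ, J (fderiv ℝ g z η)⟫ = ⟪ξ, fderiv ℝ g z η⟫ := by
      rw [hJs, hJ2]; simp
    have e2 : ⟪ξ, fderiv ℝ g z (J (fderiv ℝ g z η))⟫ = -⟪J (fderiv ℝ g z ξ), fderiv ℝ g z η⟫ := by
      rw [← hsym, hJs]; simp
    rw [e1, e2]
    simp
    ring
  obtain ⟨Sm, m1, m2, m3⟩ := near_id_diffeo (hsm (-(1/2))) h12 (hLip _ (by norm_num [abs_of_pos]))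
  obtain ⟨Sp, p1, p2, p3⟩ := near_id_diffeo (hsm (1/2)) h12 (hLip _ (by norm_num [abs_of_pos]))
  have hmder : ∀ z ξ, fderiv ℝ (fun x => x + (-(1/2):ℝ) • J (g x)) (Sm z) (fderiv ℝ Sm z ξ) = ξ := by
    intro z ξ
    have key : (fderiv ℝ (fun x => x + (-(1/2):ℝ) • J (g x)) (Sm z)).comp (fderiv ℝ Sm z)
        = ContinuousLinearMap.id ℝ Z := by
      rw [← fderiv_comp (g := fun x => x + (-(1/2):ℝ) • J (g x)) z
        ((contDiff_id.add (hsm _)).differentiable one_ne_zero _)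
        (m1.differentiable one_ne_zero _)]
      have : (fun x => x + (-(1/2):ℝ) • J (g x)) ∘ Sm = id := funext m3
      rw [this, fderiv_id]
    have := congrArg (fun L : Z →L[ℝ] Z => L ξ) key
    simpa using this
  refine ⟨fun w => Sm w + (1/2 : ℝ) • J (g (Sm w)), ⟨fun w => Sp w + (-(1/2) : ℝ) • J (g (Sp w)),
    fun x => ?_, fun x => ?_, ?_, ?_, ?_⟩, ⟨?_, ?_⟩, fun w => ⟨Sm w, ?_, rfl⟩⟩
  · simp only [p2, m3]
  · simp only [m2, p3]
  · exact m1.add ((hsm _).comp m1)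
  · exact p1.add ((hsm _).comp p1)
  · intro z ξ η
    have : fderiv ℝ (fun w => Sm w + (1/2 : ℝ) • J (g (Sm w))) z
      = (fderiv ℝ (fun x => x + (1/2 : ℝ) • J (g x)) (Sm z)).comp (fderiv ℝ Sm z) :=
      fderiv_comp (g := fun x => x + (1/2 : ℝ) • J (g x)) z
        ((contDiff_id.add (hsm _)).differentiable one_ne_zero _)
        (m1.differentiable one_ne_zero _)
    rw [this]
    have h1 := hom (1/2) (Sm z) (fderiv ℝ Sm z ξ) (fderiv ℝ Sm z η)
    have h2 := hom (-(1/2)) (Sm z) (fderiv ℝ Sm z ξ) (fderiv ℝ Sm z η)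
    rw [hmder, hmder] at h2
    simp only [ContinuousLinearMap.comp_apply]
    rw [h1, h2]; ring
  · intro x c hc
    have : Sm (x + c) = Sm x + c := by
      have e : x + c = (Sm x + c) + (-(1/2):ℝ) • J (g (Sm x + c)) := by
        rw [hP1 _ _ hc]
        conv_lhs => rw [← m3 x]
        abel
      conv_lhs => rw [e]
      rw [m2]
    simp only [this, hP1 _ _ hc]; abel
  · intro x
    have : Sm x + (1/2 : ℝ) • J (g (Sm x)) - x = J (g (Sm x)) := by
      conv_lhs => rw [← m3 x]
      rw [m2]
      module
    rw [this, hP2]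
  · conv_lhs => rw [← m3 w]
    module

lemma exists_sqrt {𝒜 : Type*} [NormedRing 𝒜] [NormedAlgebra ℝ 𝒜] [CompleteSpace 𝒜] :
    ∃ S : 𝒜 → 𝒜, ContinuousAt S 1 ∧ S 1 = 1 ∧ (∀ᶠ B in nhds (1 : 𝒜), S B * S B = B) ∧
      ∃ r > 0, ∀ x y : 𝒜, ‖x - 1‖ < r → ‖y - 1‖ < r → x * x = y * y → x = y := by
  have hd : HasStrictFDerivAt (fun x : 𝒜 => x * x)
      ((ContinuousLinearEquiv.smulLeft (Units.mk0 (2:ℝ) two_ne_zero) : 𝒜 ≃L[ℝ] 𝒜) : 𝒜 →L[ℝ] 𝒜) 1 := by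
    have h := (hasStrictFDerivAt_id (𝕜 := ℝ) (1 : 𝒜)).mul' (hasStrictFDerivAt_id (𝕜 := ℝ) (1 : 𝒜))
    have e2 : ((ContinuousLinearEquiv.smulLeft (Units.mk0 (2:ℝ) two_ne_zero) : 𝒜 ≃L[ℝ] 𝒜) : 𝒜 →L[ℝ] 𝒜)
        = id (1:𝒜) • ContinuousLinearMap.id ℝ 𝒜 + MulOpposite.op (id (1:𝒜)) • ContinuousLinearMap.id ℝ 𝒜 := by
      ext x
      simp [two_smul, Units.smul_def]
    rw [e2]
    exact h
  refine ⟨hd.localInverse _ _ _, ?_, ?_, ?_, ?_⟩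
  · have := hd.localInverse_continuousAt
    simpa using this
  · have := hd.localInverse_apply_image
    simpa using this
  · have := hd.eventually_right_inverse
    simpa using this
  · have := hd.eventually_left_inverse
    obtain ⟨r, hr, h⟩ := Metric.eventually_nhds_iff.1 this
    refine ⟨r, hr, fun x y hx hy hxy => ?_⟩
    have h1 := h (y := x) (by rwa [dist_eq_norm])
    have h2 := h (y := y) (by rwa [dist_eq_norm])
    rw [← h1, ← h2]
    exact congrArg _ hxy


lemma linear_approx_alg {𝒜 : Type*} [NormedRing 𝒜] [NormedAlgebra ℝ 𝒜] [CompleteSpace 𝒜]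
    [StarRing 𝒜] [CStarRing 𝒜] (J : 𝒜) (jj : J * J = -1) (sJ : star J = -J)
    (L L' : 𝒜) (hL1 : L * L' = 1) (hL2 : L' * L = 1) (hLL : star L * J * L = J)
    (e : ℝ) (he : 0 < e) :
    ∃ δ > 0, ∀ P : 𝒜, P * P = P → star P = P → P * J = J * P →
      ‖(L - 1) - P * (L - 1) * P‖ ≤ δ →
      ∃ M M' : 𝒜, M * M' = 1 ∧ M' * M = 1 ∧ star M * J * M = J ∧ M * (1 - P) = 1 - P ∧
        (1 - P) * M = 1 - P ∧ ‖M - L‖ ≤ e := by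
  obtain ⟨S, hSc, hS1, hSq, r, hr, huniq⟩ := exists_sqrt (𝒜 := 𝒜)
  have n1 : ‖(1 : 𝒜)‖ ≤ 1 := by
    have h1 : ‖star (1 : 𝒜) * 1‖ = ‖(1 : 𝒜)‖ * ‖(1 : 𝒜)‖ := CStarRing.norm_star_mul_self
    rw [star_one, one_mul] at h1
    nlinarith [norm_nonneg (1 : 𝒜)]
  obtain ⟨Bf, hBf⟩ : ∃ Bf : 𝒜 → 𝒜, Bf = fun A => -J * (star A * J * A) := ⟨_, rfl⟩
  have hBe : ∀ A, Bf A = -J * (star A * J * A) := fun A => by rw [hBf]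
  have hBc : Continuous Bf := by rw [hBf]; fun_prop
  have hBL : Bf L = 1 := by
    rw [hBe, hLL]; rw [neg_mul, jj, neg_neg]
  have hBt : Filter.Tendsto Bf (nhds L) (nhds 1) := by
    have := hBc.tendsto L; rwa [hBL] at this
  have hQt : Filter.Tendsto (fun A => S (Bf A)) (nhds L) (nhds 1) := by
    have : Filter.Tendsto S (nhds 1) (nhds 1) := by
      have := hSc.tendsto; rwa [hS1] at this
    exact this.comp hBt
  have hinvt : Filter.Tendsto (fun A => Ring.inverse (S (Bf A))) (nhds L) (nhds 1) := by
    have h1 := NormedRing.inverse_continuousAt (1 : 𝒜ˣ)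
    have h2 : Filter.Tendsto (Ring.inverse : 𝒜 → _) (nhds 1) (nhds 1) := by
      have := h1.tendsto
      simpa using this
    exact h2.comp hQt
  have hMt : Filter.Tendsto (fun A => A * Ring.inverse (S (Bf A))) (nhds L) (nhds L) := by
    have := (Filter.tendsto_id (x := nhds L)).mul hinvt
    simpa using this
  have ev1 : ∀ᶠ A in nhds L, S (Bf A) * S (Bf A) = Bf A := hBt.eventually hSq
  have ev2 : ∀ᶠ A in nhds L, ‖S (Bf A) - 1‖ < r / 9 := by
    have := hQt (Metric.ball_mem_nhds (1 : 𝒜) (show 0 < r/9 by positivity))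
    filter_upwards [this] with A hA
    simpa [dist_eq_norm] using hA
  have ev3 : ∀ᶠ A in nhds L, IsUnit (S (Bf A)) :=
    hQt.eventually (Units.isOpen.eventually_mem (show IsUnit (1 : 𝒜) from isUnit_one))
  have ev4 : ∀ᶠ A in nhds L, IsUnit A :=
    Units.isOpen.eventually_mem (show IsUnit L from ⟨⟨L, L', hL1, hL2⟩, rfl⟩)
  have ev5 : ∀ᶠ A in nhds L, ‖A * Ring.inverse (S (Bf A)) - L‖ ≤ e := by
    have := hMt (Metric.ball_mem_nhds L he)
    filter_upwards [this] with A hA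
    have hA' : dist _ L < e := hA
    rw [dist_eq_norm] at hA'
    exact hA'.le
  obtain ⟨δ, hδ, hall⟩ := Metric.eventually_nhds_iff.1
    (ev1.and (ev2.and (ev3.and (ev4.and ev5))))
  refine ⟨δ / 2, by positivity, fun P hPP sP hPJ hK => ?_⟩
  have nP : ‖P‖ ≤ 1 := by
    have h1 : ‖star P * P‖ = ‖P‖ * ‖P‖ := CStarRing.norm_star_mul_self
    rw [sP, hPP] at h1
    nlinarith [norm_nonneg P]
  set A : 𝒜 := 1 + P * (L - 1) * P with hA
  have hAL : dist A L < δ := by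
    rw [dist_eq_norm]
    have : A - L = -((L - 1) - P * (L - 1) * P) := by rw [hA]; abel
    rw [this, norm_neg]; linarith
  obtain ⟨q1, q2, q3, q4, q5⟩ := hall hAL
  set Q := S (Bf A) with hQ

  clear_value Q
  clear hall hQt hinvt hMt ev1 ev2 ev3 ev4 ev5 hBt hBc
  have e1 : P * (1 - P) = 0 := by rw [mul_sub, hPP]; simp
  have e2 : (1 - P) * P = 0 := by rw [sub_mul, hPP]; simp
  have e3 : (1 - P) * (1 - P) = 1 - P := by rw [mul_sub, e2]; simp
  have pA1 : (1 - P) * A = 1 - P := by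
    rw [hA, mul_add, mul_one, ← mul_assoc, ← mul_assoc, e2]; simp
  have pA2 : A * (1 - P) = 1 - P := by
    rw [hA, add_mul, one_mul, mul_assoc _ P (1 - P), e1]; simp
  have pA3 : (1 - P) * star A = 1 - P := by
    have := congrArg star pA2
    rwa [star_mul, star_sub, star_one, sP] at this
  have pA4 : star A * (1 - P) = 1 - P := by
    have := congrArg star pA1
    rwa [star_mul, star_sub, star_one, sP] at this
  clear_value A
  have pJ : (1 - P) * J = J * (1 - P) := by rw [sub_mul, mul_sub, hPJ]; simp
  have pB : (1 - P) * Bf A = 1 - P := by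
    calc (1 - P) * Bf A = -(((1 - P) * J) * (star A * J * A)) := by
          rw [hBe, neg_mul, mul_neg, mul_assoc (1 - P) J]
      _ = -(J * (((1 - P) * star A) * J * A)) := by rw [pJ]; simp only [mul_assoc]
      _ = 1 - P := by rw [pA3, pJ, mul_assoc, pA1, ← mul_assoc, jj]; simp
  have pB2 : Bf A * (1 - P) = 1 - P := by
    calc Bf A * (1 - P) = -(J * (star A * (J * (A * (1 - P))))) := by
          rw [hBe]; simp only [mul_assoc, neg_mul]
      _ = 1 - P := by rw [pA2, ← pJ, ← mul_assoc (star A), pA4, pJ, ← mul_assoc, jj]; simp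
  have hPB : P * Bf A = Bf A * P := by
    have : (1 - P) * Bf A = Bf A * (1 - P) := by rw [pB, pB2]
    rw [sub_mul, mul_sub, one_mul, mul_one] at this
    exact sub_right_inj.1 this
  have hPQ : P * Q = Q * P := by
    obtain ⟨ρ, hρd⟩ : ∃ ρ : 𝒜, ρ = P + P - 1 := ⟨_, rfl⟩
    have hρ : ρ * ρ = 1 := by
      have : ρ * ρ = P * P + P * P + P * P + P * P - P - P - P - P + 1 := by rw [hρd]; noncomm_ring
      rw [this, hPP]; abel
    have nρ : ‖ρ‖ ≤ 3 := by
      rw [hρd]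
      calc ‖P + P - 1‖ ≤ ‖P + P‖ + ‖(1 : 𝒜)‖ := norm_sub_le _ _
        _ ≤ (‖P‖ + ‖P‖) + 1 := by gcongr; exact norm_add_le _ _
        _ ≤ 3 := by linarith
    have hρB : ρ * Bf A = Bf A * ρ := by
      rw [hρd, sub_mul, mul_sub, mul_add, add_mul, hPB]; simp
    have hcomm : ρ * Q * ρ = Q := by
      apply huniq
      · have : ρ * Q * ρ - 1 = ρ * (Q - 1) * ρ := by
          rw [mul_sub, sub_mul, mul_one, hρ]
        rw [this]
        calc _ ≤ ‖ρ‖ * ‖Q - 1‖ * ‖ρ‖ :=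
              (norm_mul_le _ _).trans (by gcongr; exact norm_mul_le _ _)
          _ ≤ 3 * ‖Q - 1‖ * 3 := by gcongr
          _ < r := by linarith
      · linarith
      · calc ρ * Q * ρ * (ρ * Q * ρ) = ρ * Q * (ρ * ρ) * Q * ρ := by simp only [mul_assoc]
          _ = ρ * (Q * Q) * ρ := by rw [hρ, mul_one, mul_assoc ρ Q Q]
          _ = Q * Q := by rw [q1, hρB, mul_assoc, hρ, mul_one]
    have h1 : ρ * Q = Q * ρ := by
      calc ρ * Q = ρ * Q * (ρ * ρ) := by rw [hρ, mul_one]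
        _ = ρ * Q * ρ * ρ := by simp only [mul_assoc]
        _ = Q * ρ := by rw [hcomm]
    rw [hρd, sub_mul, mul_sub, mul_add, add_mul, one_mul, mul_one, sub_left_inj] at h1
    rw [← two_smul ℝ, ← two_smul ℝ] at h1
    exact smul_right_injective _ (two_ne_zero (α := ℝ)) h1
  have hQ1 : P * Q + (1 - P) = Q := by
    apply huniq
    · have : P * Q + (1 - P) - 1 = P * (Q - 1) := by rw [mul_sub, mul_one]; abel
      rw [this]
      calc _ ≤ ‖P‖ * ‖Q - 1‖ := norm_mul_le _ _
        _ ≤ 1 * ‖Q - 1‖ := by gcongr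
        _ < r := by linarith
    · linarith
    · calc (P * Q + (1 - P)) * (P * Q + (1 - P))
          = (P * Q) * (P * Q) + (P * Q) * (1 - P) + ((1 - P) * P) * Q + (1 - P) * (1 - P) := by
            noncomm_ring
        _ = P * (Q * Q) + (1 - P) := by
            have a1 : P * Q * (P * Q) = P * (Q * Q) := by
              calc P * Q * (P * Q) = P * (Q * P) * Q := by simp only [mul_assoc]
                _ = _ := by rw [← hPQ, ← mul_assoc, hPP, mul_assoc]
            have a2 : P * Q * (1 - P) = 0 := by
              rw [hPQ, mul_assoc, e1, mul_zero]
            rw [e2, e3, a1, a2]; simp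
        _ = P * Bf A + (1 - P) * Bf A := by rw [q1, pB]
        _ = Q * Q := by rw [q1, sub_mul]; simp
  have hQ2 : (1 - P) * Q = 1 - P := by
    calc (1 - P) * Q = (1 - P) * (P * Q + (1 - P)) := by rw [hQ1]
      _ = 1 - P := by rw [mul_add, ← mul_assoc, e2, e3]; simp
  have hQ3 : Q * (1 - P) = 1 - P := by
    rw [mul_sub, mul_one, ← hPQ]
    rw [sub_mul, one_mul] at hQ2
    exact hQ2
  have hσ : -J * star Q * J = Q := by
    have nJ : ‖J‖ ≤ 1 := by
      have h1 : ‖star J * J‖ = ‖J‖ * ‖J‖ := CStarRing.norm_star_mul_self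
      rw [sJ, neg_mul, jj, neg_neg] at h1
      nlinarith [norm_nonneg J]
    apply huniq
    · have : -J * star Q * J - 1 = -J * star (Q - 1) * J := by
        rw [star_sub, star_one, mul_sub, sub_mul, mul_one, neg_mul J J, jj, neg_neg]
      rw [this]
      calc _ ≤ ‖-J‖ * ‖star (Q - 1)‖ * ‖J‖ :=
            (norm_mul_le _ _).trans (by gcongr; exact norm_mul_le _ _)
        _ ≤ 1 * ‖Q - 1‖ * 1 := by rw [norm_neg, norm_star]; gcongr
        _ < r := by linarith
    · linarith
    · calc -J * star Q * J * (-J * star Q * J) = -J * star Q * (-(J * J)) * star Q * J := by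
            noncomm_ring
        _ = -J * star (Q * Q) * J := by rw [jj, neg_neg, mul_one, mul_assoc (-J), ← star_mul]
        _ = -J * (star A * (star J * A) * star (-J)) * J := by
            rw [q1, hBe, star_mul, star_mul, star_mul, star_star]
        _ = -(J * star A * J * A) * (-(J * J)) := by
            rw [star_neg, sJ]; noncomm_ring
        _ = Q * Q := by rw [jj, q1, hBe]; noncomm_ring
  have hσ2 : star Q * J = J * Q := by
    calc star Q * J = -(J * J) * star Q * J := by rw [jj]; simp
      _ = J * (-J * star Q * J) := by noncomm_ring
      _ = _ := by rw [hσ]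
  obtain ⟨q, hq⟩ := q3
  obtain ⟨a, ha⟩ := q4
  have hinv : Ring.inverse Q = ((q⁻¹ : 𝒜ˣ) : 𝒜) := by
    rw [← hq, Ring.inverse_unit]
  rw [hinv] at q5
  have cq0 : ((q⁻¹ : 𝒜ˣ) : 𝒜) * Q = 1 := by rw [← hq, Units.inv_mul]
  have cq1 : Q * ((q⁻¹ : 𝒜ˣ) : 𝒜) = 1 := by rw [← hq, Units.mul_inv]
  have ca0 : ((a⁻¹ : 𝒜ˣ) : 𝒜) * A = 1 := by rw [← ha, Units.inv_mul]
  have ca1 : A * ((a⁻¹ : 𝒜ˣ) : 𝒜) = 1 := by rw [← ha, Units.mul_inv]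
  generalize ((q⁻¹ : 𝒜ˣ) : 𝒜) = q' at *
  generalize ((a⁻¹ : 𝒜ˣ) : 𝒜) = a' at *
  have cq : q' * (1 - P) = 1 - P := by
    calc q' * (1 - P) = q' * Q * (1 - P) := by rw [mul_assoc, hQ3]
      _ = _ := by rw [cq0, one_mul]
  have cq2 : (1 - P) * q' = 1 - P := by
    calc (1 - P) * q' = (1 - P) * (Q * q') := by rw [← mul_assoc, hQ2]
      _ = _ := by rw [cq1, mul_one]
  have e0 : star A * J * A = star Q * J * Q := by
    calc star A * J * A = J * (-J * (star A * J * A)) := by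
          rw [← mul_assoc J, mul_neg, jj]; simp
      _ = J * (Q * Q) := by rw [q1, hBe]
      _ = _ := by rw [← mul_assoc, hσ2]
  refine ⟨A * q', Q * a', ?_, ?_, ?_, ?_, ?_, q5⟩
  · rw [mul_assoc, ← mul_assoc q', cq0, one_mul, ca1]
  · rw [mul_assoc, ← mul_assoc a', ca0, one_mul, cq1]
  · calc star (A * q') * J * (A * q') = star q' * (star A * J * A) * q' := by
          rw [star_mul]; simp only [mul_assoc]
      _ = star (Q * q') * J * (Q * q') := by rw [e0, star_mul]; simp only [mul_assoc]
      _ = J := by rw [cq1]; simp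
  · rw [mul_assoc, cq, pA2]
  · rw [← mul_assoc, pA1, cq2]

lemma linear_approx (J : Z →L[ℝ] Z) (hJ2 : ∀ x, J (J x) = -x)
    (hJs : ∀ x y, ⟪J x, y⟫ = -⟪x, J y⟫)
    (L L' : Z →L[ℝ] Z) (hL1 : L * L' = 1) (hL2 : L' * L = 1)
    (hLs : ∀ ξ η, ⟪J (L ξ), L η⟫ = ⟪J ξ, η⟫) (e : ℝ) (he : 0 < e) :
    ∃ δ > 0, ∀ P : Z →L[ℝ] Z, P * P = P → (∀ x y, ⟪P x, y⟫ = ⟪x, P y⟫) → P * J = J * P →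
      ‖(L - 1) - P * (L - 1) * P‖ ≤ δ →
      ∃ M : Z →L[ℝ] Z, SD J M ∧ QF P M ∧ ‖M - L‖ ≤ e := by
  have jj : J * J = -1 := by ext x; simp [hJ2]
  have sJ : star J = -J := by
    rw [ContinuousLinearMap.star_eq_adjoint]
    refine (ContinuousLinearMap.eq_adjoint_iff (-J) J).2 (fun x y => ?_) |>.symm
    simp [hJs]
  have hLL : star L * J * L = J := by
    ext x
    refine ext_inner_right ℝ fun y => ?_
    simp only [ContinuousLinearMap.mul_apply, ContinuousLinearMap.star_eq_adjoint,
      ContinuousLinearMap.adjoint_inner_left, hLs]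
  obtain ⟨δ, hδ, H⟩ := linear_approx_alg J jj sJ L L' hL1 hL2 hLL e he
  refine ⟨δ, hδ, fun P hPP hPs hPJ hK => ?_⟩
  have sP : star P = P := by
    rw [ContinuousLinearMap.star_eq_adjoint]
    exact ((ContinuousLinearMap.eq_adjoint_iff P P).2 hPs).symm
  obtain ⟨M, M', h1, h2, hsym, h3, h4, h5⟩ := H P hPP sP hPJ hK
  refine ⟨M, ⟨M', fun x => ?_, fun x => ?_, M.contDiff,
    ContinuousLinearMap.contDiff _, fun z ξ η => ?_⟩, ⟨fun x c hc => ?_, fun x => ?_⟩, h5⟩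
  · rw [← ContinuousLinearMap.mul_apply, h2]; rfl
  · rw [← ContinuousLinearMap.mul_apply, h1]; rfl
  · rw [M.fderiv]
    have h2 : ⟪(star M * J * M) ξ, η⟫ = ⟪J ξ, η⟫ := by rw [hsym]
    simpa only [ContinuousLinearMap.mul_apply, ContinuousLinearMap.star_eq_adjoint,
      ContinuousLinearMap.adjoint_inner_left] using h2
  · have h2 := congrArg (fun X : Z →L[ℝ] Z => X c) h3
    simp [hc] at h2
    rw [map_add, h2]
  · have h2 := congrArg (fun X : Z →L[ℝ] Z => X x) h4
    simp at h2
    rw [map_sub]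
    rw [sub_eq_sub_iff_sub_eq_sub] at h2
    exact h2.symm

open scoped Convolution in
lemma mollify_fd {E : Type*} [NormedAddCommGroup E] [InnerProductSpace ℝ E]
    [FiniteDimensional ℝ E] (F : E → ℝ) (hF : ContDiff ℝ 1 F) (r δ : ℝ) (hr : 0 < r)
    (hδ : 0 < δ) : ∃ q : E → ℝ, ContDiff ℝ 2 q ∧ HasCompactSupport q ∧
      ∀ y, ‖y‖ ≤ r → ‖fderiv ℝ q y - fderiv ℝ F y‖ ≤ δ := by
  borelize E
  let χ : ContDiffBump (0 : E) := ⟨r + 1, r + 2, by linarith, by linarith⟩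
  let F₁ : E → ℝ := fun y => χ y * F y
  have hF₁ : ContDiff ℝ 1 F₁ := χ.contDiff.mul hF
  have hc₁ : HasCompactSupport F₁ := χ.hasCompactSupport.mul_right
  have hder : ∀ y, ‖y‖ ≤ r → fderiv ℝ F₁ y = fderiv ℝ F y := by
    intro y hy
    apply Filter.EventuallyEq.fderiv_eq
    have : Metric.closedBall (0 : E) (r + 1) ∈ nhds y := by
      refine Filter.mem_of_superset (Metric.ball_mem_nhds y one_pos) fun z hz => ?_
      rw [mem_ball_iff_norm] at hz
      rw [mem_closedBall_zero_iff]
      calc ‖z‖ = ‖y + (z - y)‖ := by simp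
        _ ≤ ‖y‖ + ‖z - y‖ := norm_add_le _ _
        _ ≤ r + 1 := by linarith
    filter_upwards [this] with z hz
    simp only [F₁]
    rw [χ.one_of_mem_closedBall hz, one_mul]
  have hdc : Continuous (fderiv ℝ F₁) := hF₁.continuous_fderiv one_ne_zero
  have huc : UniformContinuous (fderiv ℝ F₁) :=
    (hc₁.fderiv ℝ).uniformContinuous_of_continuous hdc
  obtain ⟨ρ, hρ, hu⟩ := Metric.uniformContinuous_iff.1 huc δ hδ
  let φ : ContDiffBump (0 : E) := ⟨ρ / 2, ρ, by linarith, by linarith⟩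
  let μ : MeasureTheory.Measure E := MeasureTheory.volume
  refine ⟨(φ.normed μ ⋆[ContinuousLinearMap.lsmul ℝ ℝ, μ] F₁ : E → ℝ), ?_, ?_, ?_⟩
  · exact φ.hasCompactSupport_normed.contDiff_convolution_left _ φ.contDiff_normed
      hF₁.continuous.locallyIntegrable
  · exact φ.hasCompactSupport_normed.convolution _ hc₁
  · intro y hy
    have h1 := hc₁.hasFDerivAt_convolution_right (μ := μ) (ContinuousLinearMap.lsmul ℝ ℝ)
      (φ.continuous_normed (μ := μ)).locallyIntegrable hF₁ y
    rw [h1.fderiv, ← hder y hy]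
    have h2 := φ.dist_normed_convolution_le (μ := μ) (g := fderiv ℝ F₁) (x₀ := y) (ε := δ)
      hdc.aestronglyMeasurable (fun x hx => (hu hx).le)
    rw [dist_eq_norm] at h2
    have h3 : (ContinuousLinearMap.lsmul ℝ ℝ : ℝ →L[ℝ] ℝ →L[ℝ] ℝ).precompR E
        = (ContinuousLinearMap.lsmul ℝ ℝ : ℝ →L[ℝ] (E →L[ℝ] ℝ) →L[ℝ] (E →L[ℝ] ℝ)) := by
      ext; simp
    rw [h3]
    exact h2

lemma mollify (f : Z → ℝ) (hf : ContDiff ℝ 1 f) (P : Z →L[ℝ] Z) (hPP : ∀ x, P (P x) = P x)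
    (hPs : ∀ x y, ⟪P x, y⟫ = ⟪x, P y⟫) (hfin : FiniteDimensional ℝ P.range)
    (r δ : ℝ) (hr : 0 < r) (hδ : 0 < δ) :
    ∃ g : Z → Z, ContDiff ℝ 1 g ∧ (∀ z ξ η, ⟪fderiv ℝ g z ξ, η⟫ = ⟪ξ, fderiv ℝ g z η⟫) ∧
      (∃ c : ℝ≥0, LipschitzWith c g) ∧ (∃ B : ℝ, ∀ x, ‖g x‖ ≤ B) ∧
      (∀ x c, P c = 0 → g (x + c) = g x) ∧ (∀ x, P (g x) = g x) ∧
      ∀ z, P z = z → ‖z‖ ≤ r → ‖g z - P (gradient f z)‖ ≤ δ := by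
  let E := P.range
  let ι : E →L[ℝ] Z := E.subtypeL
  let π : Z →L[ℝ] E := P.codRestrict E (fun x => ⟨x, rfl⟩)
  have hιπ : ∀ z, ι (π z) = P z := fun z => rfl
  have hPι : ∀ y : E, P (ι y) = ι y := by
    rintro ⟨_, x, rfl⟩; exact hPP x
  have hadj : ∀ (y : E) (z : Z), ⟪ι y, z⟫ = ⟪y, π z⟫ := by
    intro y z
    rw [← hPι y, hPs, ← hιπ]; rfl
  obtain ⟨q, hq, hqc, hqd⟩ := mollify_fd (fun y : E => f (ι y)) (hf.comp ι.contDiff) r δ hr hδ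
  let T := (InnerProductSpace.toDual ℝ E).symm.toContinuousLinearEquiv.toContinuousLinearMap
  let k : E → E := fun y => T (fderiv ℝ q y)
  have hk : ∀ y v, ⟪k y, v⟫ = fderiv ℝ q y v := fun y v =>
    InnerProductSpace.toDual_symm_apply
  have hdq : ContDiff ℝ 1 (fderiv ℝ q) := hq.fderiv_right (by norm_num)
  have hk1 : ContDiff ℝ 1 k := T.contDiff.comp hdq
  have hkc : HasCompactSupport k := (hqc.fderiv ℝ).comp_left (map_zero T)
  obtain ⟨c, hc⟩ := hk1.lipschitzWith_of_hasCompactSupport hkc one_ne_zero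
  obtain ⟨B, hB⟩ := hkc.exists_bound_of_continuous hk1.continuous
  have hg1 : ContDiff ℝ 1 (fun z => ι (k (π z))) := ι.contDiff.comp (hk1.comp π.contDiff)
  have hgd : ∀ z ξ η, ⟪fderiv ℝ (fun z => ι (k (π z))) z ξ, η⟫
      = fderiv ℝ (fderiv ℝ q) (π z) (π ξ) (π η) := by
    intro z ξ η
    have h1 : HasFDerivAt (fun z => ι (k (π z))) (ι.comp ((T.comp (fderiv ℝ (fderiv ℝ q) (π z))).comp π)) z := by
      refine ι.hasFDerivAt.comp z (HasFDerivAt.comp z (g := k) ?_ π.hasFDerivAt)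
      exact T.hasFDerivAt.comp _ ((hdq.differentiable one_ne_zero) _).hasFDerivAt
    rw [h1.fderiv]
    simp only [ContinuousLinearMap.comp_apply]
    rw [hadj]
    exact InnerProductSpace.toDual_symm_apply
  refine ⟨fun z => ι (k (π z)), hg1, ?_, ?_, ⟨B, fun x => hB _⟩, ?_, fun x => hPι _, ?_⟩
  · intro z ξ η
    rw [hgd z ξ η, real_inner_comm, hgd z η ξ]
    have := (hq.contDiffAt (x := π z)).isSymmSndFDerivAt (by simp)
    exact this _ _
  · exact ⟨_, ι.lipschitz.comp (hc.comp π.lipschitz)⟩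
  · intro x c hc
    have : π c = 0 := by
      apply Subtype.ext; exact hc
    simp [this]
  · intro z hz hzr
    have key : ∀ η, ⟪ι (k (π z)) - P (gradient f z), η⟫ ≤ δ * ‖η‖ := by
      intro η
      have h1 : ‖π z‖ ≤ r := by
        have : ‖π z‖ = ‖P z‖ := rfl
        rw [this, hz]; exact hzr
      have hh := hqd (π z) h1
      have h2 : fderiv ℝ (fun y : E => f (ι y)) (π z) = (fderiv ℝ f z).comp ι := by
        have : HasFDerivAt (fun y : E => f (ι y)) ((fderiv ℝ f (ι (π z))).comp ι) (π z) :=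
          ((hf.differentiable one_ne_zero) _).hasFDerivAt.comp _ ι.hasFDerivAt
        rw [this.fderiv, hιπ, hz]
      have h3 : ⟪P (gradient f z), η⟫ = fderiv ℝ f z (P η) := by
        rw [hPs]; exact InnerProductSpace.toDual_symm_apply
      rw [inner_sub_left, hadj, hk, h3]
      have h4 := (fderiv ℝ q (π z) - fderiv ℝ (fun y : E => f (ι y)) (π z)).le_opNorm (π η)
      rw [h2] at h4 hh
      have h5 : ‖π η‖ ≤ ‖η‖ := by
        have h6 : ‖π η‖ ^ 2 = ⟪P η, η⟫ := by
          rw [hPs, ← hPP, ← hPs, real_inner_self_eq_norm_sq]; rfl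
        have h7 := real_inner_le_norm (P η) η
        have h8 : ‖π η‖ = ‖P η‖ := rfl
        rw [← h8] at h7
        nlinarith [norm_nonneg (π η), norm_nonneg η]
      have h9 := (Real.norm_eq_abs _ ▸ le_abs_self ((fderiv ℝ q (π z) - (fderiv ℝ f z).comp ι) (π η))).trans h4
      calc _ = (fderiv ℝ q (π z) - (fderiv ℝ f z).comp ι) (π η) := by
            simp [hιπ]
        _ ≤ _ := h9
        _ ≤ _ := by gcongr
    have h1 := key (ι (k (π z)) - P (gradient f z))
    rw [real_inner_self_eq_norm_sq] at h1
    by_contra hcon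
    push Not at hcon
    nlinarith [norm_nonneg (ι (k (π z)) - P (gradient f z))]

lemma Vl_deriv {V : Z → Z} (hV : ContDiff ℝ 1 V) (y : Z) {l : ℝ} (hl : l ≠ 0) :
    HasDerivAt (fun s : ℝ => s⁻¹ • V (s • y))
      (l⁻¹ • fderiv ℝ V (l • y) y - (l ^ 2)⁻¹ • V (l • y)) l := by
  have h1 : HasDerivAt (fun s : ℝ => V (s • y)) (fderiv ℝ V (l • y) y) l := by
    have h2 : HasDerivAt (fun s : ℝ => s • y) y l := by
      simpa using (hasDerivAt_id l).smul_const y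
    exact ((hV.differentiable one_ne_zero) (l • y)).hasFDerivAt.comp_hasDerivAt l h2
  have h3 := (hasDerivAt_inv hl).smul h1
  refine HasDerivAt.congr_deriv h3 ?_
  rw [neg_smul, sub_eq_add_neg]

lemma unif_diff {V : Z → Z} (hV : ContDiff ℝ 1 V) (K : Set Z) (hK : IsCompact K) (l0 : ℝ)
    (hl0 : 0 < l0) (e : ℝ) (he : 0 < e) :
    ∃ t0 > 0, ∀ t, 0 < t → t ≤ t0 → ∀ l, l0 ≤ l → l + t ≤ 1 → ∀ y ∈ K,
      ‖(l + t)⁻¹ • V ((l + t) • y) - l⁻¹ • V (l • y)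
        - t • (l⁻¹ • fderiv ℝ V (l • y) y - (l ^ 2)⁻¹ • V (l • y))‖ ≤ t * e := by
  let D : ℝ × Z → Z := fun p => p.1⁻¹ • fderiv ℝ V (p.1 • p.2) p.2 - (p.1 ^ 2)⁻¹ • V (p.1 • p.2)
  have hfd : Continuous (fderiv ℝ V) := hV.continuous_fderiv one_ne_zero
  have hc : ContinuousOn D (Set.Icc l0 1 ×ˢ K) := by
    have h1 : ContinuousOn (fun p : ℝ × Z => p.1⁻¹) (Set.Icc l0 1 ×ˢ K) :=
      continuousOn_fst.inv₀ fun p hp => (hl0.trans_le hp.1.1).ne'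
    have h2 : ContinuousOn (fun p : ℝ × Z => (p.1 ^ 2)⁻¹) (Set.Icc l0 1 ×ˢ K) :=
      (continuousOn_fst.pow 2).inv₀ fun p hp => (pow_pos (hl0.trans_le hp.1.1) 2).ne'
    have h3 : Continuous (fun p : ℝ × Z => fderiv ℝ V (p.1 • p.2) p.2) :=
      (hfd.comp (continuous_fst.smul continuous_snd)).clm_apply continuous_snd
    have h4 : Continuous (fun p : ℝ × Z => V (p.1 • p.2)) :=
      hV.continuous.comp (continuous_fst.smul continuous_snd)
    exact (h1.smul h3.continuousOn).sub (h2.smul h4.continuousOn)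
  have huc := (isCompact_Icc.prod hK).uniformContinuousOn_of_continuous hc
  obtain ⟨t0, ht0, hu⟩ := Metric.uniformContinuousOn_iff.1 huc e he
  refine ⟨t0 / 2, by positivity, fun t ht htt l hl hlt y hy => ?_⟩
  have hlpos : 0 < l := hl0.trans_le hl
  have hmv := Convex.norm_image_sub_le_of_norm_hasDerivWithin_le
    (f := fun s : ℝ => s⁻¹ • V (s • y) - s • D (l, y)) (f' := fun s => D (s, y) - D (l, y))
    (s := Set.Icc l (l + t)) (x := l) (y := l + t) (C := e) ?_ ?_ (convex_Icc _ _)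
    (Set.left_mem_Icc.2 (by linarith)) (Set.right_mem_Icc.2 (by linarith))
  · have e1 : ‖l + t - l‖ = t := by rw [add_sub_cancel_left, Real.norm_eq_abs, abs_of_pos ht]
    rw [e1, mul_comm] at hmv
    refine le_trans (le_of_eq ?_) hmv
    congr 1
    simp only [add_smul, D]
    abel
  · intro s hs
    have hs0 : s ≠ 0 := (hlpos.trans_le hs.1).ne'
    refine HasDerivAt.hasDerivWithinAt ?_
    have h1 := (Vl_deriv hV y hs0).sub ((hasDerivAt_id s).smul_const (D (l, y)))
    refine HasDerivAt.congr_deriv h1 ?_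
    simp [D]
  · intro s hs
    rw [← dist_eq_norm]
    refine (hu (s, y) ⟨⟨by linarith [hs.1], by linarith [hs.2]⟩, hy⟩ (l, y)
      ⟨⟨hl, by linarith⟩, hy⟩ ?_).le
    rw [Prod.dist_eq]
    simp only [dist_self]
    rw [max_eq_left dist_nonneg, Real.dist_eq, abs_lt]
    constructor <;> linarith [hs.1, hs.2]

set_option maxHeartbeats 1000000 in
lemma step (J : Z →L[ℝ] Z) (hJ2 : ∀ x, J (J x) = -x) (hJs : ∀ x y, ⟪J x, y⟫ = -⟪x, J y⟫)
    (hJn : ∀ x, ‖J x‖ = ‖x‖)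
    {V W : Z → Z} (hV : ContDiff ℝ 1 V) (hW : Continuous W) (hVW : ∀ x, V (W x) = x)
    (hWV : ∀ x, W (V x) = x) (P : Z →L[ℝ] Z) (hPP : ∀ x, P (P x) = P x)
    (hfin : FiniteDimensional ℝ P.range)
    (R r C2 : ℝ) (hr : 0 < r) (hC2 : 0 ≤ C2)
    (hVr : ∀ l : ℝ, 0 < l → l ≤ 1 → ∀ y, ‖y‖ ≤ R + 1 → ‖V (l • y)‖ ≤ l * r)
    (hWL : ∀ a b, ‖a‖ ≤ r + 1 → ‖b‖ ≤ r + 1 → ‖W a - W b‖ ≤ C2 * ‖a - b‖)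
    (l0 e1 : ℝ) (hl0 : 0 < l0) (he1 : 0 < e1)
    {g : Z → Z} (hg : ContDiff ℝ 1 g) (hsym : ∀ z ξ η, ⟪fderiv ℝ g z ξ, η⟫ = ⟪ξ, fderiv ℝ g z η⟫)
    {c : ℝ≥0} (hL : LipschitzWith c g) {B : ℝ} (hB : ∀ x, ‖g x‖ ≤ B)
    (hP1 : ∀ x c, P c = 0 → g (x + c) = g x) (hP2 : ∀ x, P (J (g x)) = J (g x))
    (hgY : ∀ z, P z = z → ‖z‖ ≤ r → ‖J (g z) - (fderiv ℝ V (W z) (W z) - z)‖ ≤ e1) :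
    ∃ t0 > 0, ∀ t, 0 < t → t ≤ t0 → ∀ l, l0 ≤ l → l + t ≤ 1 → ∃ G : Z → Z, SD J G ∧ QF P G ∧
      ∀ w, P w = w → ‖l⁻¹ • W (l • w)‖ ≤ R + 1 →
        ‖(l + t)⁻¹ • W ((l + t) • G w) - l⁻¹ • W (l • w)‖ ≤ t * (C2 * ((l0 ^ 2)⁻¹ * e1 + e1)) := by
  let S : Set Z := (fun y : P.range => (y : Z)) '' (Metric.closedBall 0 r)
  have hS : IsCompact S := (isCompact_closedBall _ _).image continuous_subtype_val
  have hSm : ∀ w, P w = w → ‖w‖ ≤ r → w ∈ S := fun w hw hwr =>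
    ⟨⟨w, w, hw⟩, by rw [mem_closedBall_zero_iff]; exact hwr, rfl⟩
  let K : Set Z := (fun p : ℝ × Z => p.1⁻¹ • W (p.1 • p.2)) '' (Set.Icc l0 1 ×ˢ S)
  have hK : IsCompact K := by
    refine (isCompact_Icc.prod hS).image_of_continuousOn ?_
    refine ContinuousOn.smul (continuousOn_fst.inv₀ fun p hp => (hl0.trans_le hp.1.1).ne') ?_
    exact (hW.comp (continuous_fst.smul continuous_snd)).continuousOn
  obtain ⟨t1, ht1, hud⟩ := unif_diff hV K hK l0 hl0 (e1 / 2) (by positivity)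
  have hB0 : 0 ≤ B := (norm_nonneg _).trans (hB 0)
  set q := (l0 ^ 2)⁻¹ with hq
  have hq0 : 0 < q := by positivity
  let M : ℝ := q * (c + 1) * (1 + B) * (1 + q)
  have hM : 0 < M := by positivity
  refine ⟨min t1 (min (1 / M) (e1 / (2 * M))), by positivity, fun t ht htt l hl hlt => ?_⟩
  have htt1 : t ≤ t1 := htt.trans (min_le_left _ _)
  have htM : t * M ≤ 1 := by
    have := htt.trans ((min_le_right _ _).trans (min_le_left _ _))
    rwa [le_div_iff₀ hM] at this
  have hte : t * M ≤ e1 / 2 := by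
    have := htt.trans ((min_le_right _ _).trans (min_le_right _ _))
    rw [le_div_iff₀ (by positivity)] at this
    linarith
  have hlpos : 0 < l := hl0.trans_le hl
  have hl1 : l ≤ 1 := by linarith
  have hql : (l ^ 2)⁻¹ ≤ q := by rw [hq]; gcongr
  have hql0 : 0 < (l ^ 2)⁻¹ := by positivity
  set p := (l ^ 2)⁻¹ with hp
  -- numeric consequences
  have n1 : t * q * c ≤ 1 := by
    have : q * c ≤ M := by
      calc q * c ≤ q * (c + 1) := by gcongr; linarith
        _ = q * (c + 1) * 1 * 1 := by ring
        _ ≤ M := by simp only [M]; gcongr <;> linarith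
    calc t * q * c = t * (q * c) := by ring
      _ ≤ t * M := by gcongr
      _ ≤ 1 := htM
  have n2 : t * q * B ≤ 1 := by
    have : q * B ≤ M := by
      calc q * B ≤ q * 1 * (1 + B) * 1 := by nlinarith
        _ ≤ M := by simp only [M]; gcongr <;> linarith [c.2]
    calc t * q * B = t * (q * B) := by ring
      _ ≤ t * M := by gcongr
      _ ≤ 1 := htM
  have n3 : q * (c * (t * q * B)) ≤ e1 / 2 := by
    have : q * (c * (q * B)) ≤ M := by
      calc q * (c * (q * B)) = q * c * B * q := by ring
        _ ≤ M := by simp only [M]; gcongr <;> linarith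
    calc q * (c * (t * q * B)) = t * (q * (c * (q * B))) := by ring
      _ ≤ t * M := by gcongr
      _ ≤ _ := hte
  let g' : Z → Z := fun z => (t * p) • g (l • z)
  have hg' : ContDiff ℝ 1 g' :=
    contDiff_const.smul (hg.comp (contDiff_const.smul contDiff_id))
  have hfd' : ∀ z ξ, fderiv ℝ g' z ξ = (t * p * l) • fderiv ℝ g (l • z) ξ := by
    intro z ξ
    have h1 : HasFDerivAt (fun z : Z => l • z) (l • ContinuousLinearMap.id ℝ Z) z :=
      (hasFDerivAt_id z).const_smul l
    have h2 : HasFDerivAt g' ((t * p) • ((fderiv ℝ g (l • z)).comp (l • ContinuousLinearMap.id ℝ Z))) z :=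
      (((hg.differentiable one_ne_zero) (l • z)).hasFDerivAt.comp z h1).const_smul (t * p)
    rw [h2.fderiv]
    simp [mul_smul]
  have hLip' : LipschitzWith 1 g' := by
    refine LipschitzWith.of_dist_le_mul fun x y => ?_
    simp only [g']
    rw [dist_eq_norm, dist_eq_norm, ← smul_sub, norm_smul, Real.norm_eq_abs, abs_of_pos (by positivity)]
    have h1 := hL.norm_sub_le (l • x) (l • y)
    rw [← smul_sub, norm_smul, Real.norm_eq_abs, abs_of_pos hlpos] at h1
    calc t * p * ‖g (l • x) - g (l • y)‖ ≤ t * q * (c * (l * ‖x - y‖)) := by gcongr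
      _ ≤ t * q * (c * (1 * ‖x - y‖)) := by gcongr
      _ = (t * q * c) * ‖x - y‖ := by ring
      _ ≤ 1 * ‖x - y‖ := by gcongr
      _ = _ := by simp
  obtain ⟨G, hSD, hQF, hG⟩ := cayley J hJ2 hJs hg' (by
      intro z ξ η
      rw [hfd', hfd', real_inner_smul_left, real_inner_smul_right, hsym]) le_rfl hLip' P
    (by
      intro x c hc
      simp only [g']
      rw [smul_add, hP1 _ _ (by rw [map_smul, hc, smul_zero])])
    (by
      intro x
      simp only [g', map_smul, hP2])
  refine ⟨G, hSD, hQF, fun w hw hwR => ?_⟩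
  obtain ⟨m, hm1, hm2⟩ := hG w
  set y := l⁻¹ • W (l • w) with hy
  have hly : l • y = W (l • w) := by rw [hy, smul_smul, mul_inv_cancel₀ hlpos.ne', one_smul]
  have hVy : V (l • y) = l • w := by rw [hly, hVW]
  have hwr : ‖w‖ ≤ r := by
    have h1 := hVr l hlpos hl1 y hwR
    rw [hVy, norm_smul, Real.norm_eq_abs, abs_of_pos hlpos] at h1
    exact le_of_mul_le_mul_left h1 hlpos
  have hyK : y ∈ K := ⟨(l, w), ⟨⟨hl, hl1⟩, hSm w hw hwr⟩, rfl⟩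
  clear_value y
  have hu := hud t ht htt1 l hl hlt y hyK
  have hg'n : ∀ z, ‖g' z‖ ≤ t * q * B := by
    intro z
    simp only [g']
    rw [norm_smul, Real.norm_eq_abs, abs_of_pos (by positivity)]
    have := hB (l • z)
    gcongr
  have hmw : ‖m - w‖ ≤ t * q * B := by
    have : m - w = (1/2 : ℝ) • J (g' m) := by rw [hm1]; abel
    rw [this, norm_smul, hJn]
    have := hg'n m
    have h0 := norm_nonneg (g' m)
    norm_num
    linarith
  have hGw : G w - w = J (g' m) := by
    rw [hm2, hm1]
    have : m + (1/2 : ℝ) • J (g' m) - (m - (1/2 : ℝ) • J (g' m)) = ((1/2 : ℝ) + 1/2) • J (g' m) := by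
      rw [add_smul]; abel
    rw [this]; norm_num
  have hlw : P (l • w) = l • w := by rw [map_smul, hw]
  have hlwr : ‖l • w‖ ≤ r := by
    rw [norm_smul, Real.norm_eq_abs, abs_of_pos hlpos]
    exact (mul_le_of_le_one_left (norm_nonneg _) hl1).trans hwr
  have hY := hgY (l • w) hlw hlwr
  -- D = p • Y
  have hD : l⁻¹ • fderiv ℝ V (l • y) y - p • V (l • y) = p • (fderiv ℝ V (W (l • w)) (W (l • w)) - l • w) := by
    have : l⁻¹ = p * l := by rw [hp]; field_simp
    rw [hVy, ← hly, map_smul, this]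
    simp only [smul_sub, smul_smul]
  rw [hD] at hu
  have hA : ‖G w - w - t • p • (fderiv ℝ V (W (l • w)) (W (l • w)) - l • w)‖ ≤ t * (q * e1 + e1 / 2) := by
    rw [hGw]
    have : J (g' m) - t • p • (fderiv ℝ V (W (l • w)) (W (l • w)) - l • w)
        = (t * p) • (J (g (l • m) - g (l • w)) + (J (g (l • w)) - (fderiv ℝ V (W (l • w)) (W (l • w)) - l • w))) := by
      simp only [g']
      rw [smul_smul, map_smul, ← smul_sub, map_sub]
      congr 1; abel
    rw [this, norm_smul, Real.norm_eq_abs, abs_of_pos (by positivity)]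
    have h1 := hL.norm_sub_le (l • m) (l • w)
    rw [← smul_sub, norm_smul, Real.norm_eq_abs, abs_of_pos hlpos] at h1
    have h2 : ‖g (l • m) - g (l • w)‖ ≤ c * (t * q * B) := by
      refine h1.trans (mul_le_mul_of_nonneg_left ?_ c.2)
      exact (mul_le_of_le_one_left (norm_nonneg _) hl1).trans hmw
    calc _ ≤ t * p * (‖J (g (l • m) - g (l • w))‖ + ‖J (g (l • w)) - (fderiv ℝ V (W (l • w)) (W (l • w)) - l • w)‖) := by
          gcongr; exact norm_add_le _ _
      _ ≤ t * q * (c * (t * q * B) + e1) := by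
          rw [hJn]; gcongr
      _ = t * (q * e1 + q * (c * (t * q * B))) := by ring
      _ ≤ _ := by gcongr
  have hE : ‖G w - (l + t)⁻¹ • V ((l + t) • y)‖ ≤ t * (q * e1 + e1) := by
    have hw2 : l⁻¹ • V (l • y) = w := by rw [hVy, smul_smul, inv_mul_cancel₀ hlpos.ne', one_smul]
    rw [hw2] at hu
    have := norm_sub_le (G w - w - t • p • (fderiv ℝ V (W (l • w)) (W (l • w)) - l • w))
      ((l + t)⁻¹ • V ((l + t) • y) - w - t • p • (fderiv ℝ V (W (l • w)) (W (l • w)) - l • w))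
    calc _ = _ := by congr 1; abel
      _ ≤ _ := this
      _ ≤ t * (q * e1 + e1 / 2) + t * (e1 / 2) := add_le_add hA hu
      _ = _ := by ring
  have hlt0 : 0 < l + t := by linarith
  have hGn : ‖(l + t) • G w‖ ≤ r + 1 := by
    rw [norm_smul, Real.norm_eq_abs, abs_of_pos hlt0]
    have h1 : ‖G w‖ ≤ r + 1 := by
      calc ‖G w‖ = ‖w + (G w - w)‖ := by simp
        _ ≤ ‖w‖ + ‖G w - w‖ := norm_add_le _ _
        _ ≤ r + t * q * B := by rw [hGw, hJn]; exact add_le_add hwr (hg'n m)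
        _ ≤ _ := by linarith
    exact (mul_le_of_le_one_left (norm_nonneg _) hlt).trans h1
  have hVn : ‖V ((l + t) • y)‖ ≤ r + 1 := by
    have := hVr (l + t) hlt0 hlt y hwR
    have h2 : (l + t) * r ≤ r := mul_le_of_le_one_left hr.le hlt
    linarith
  have hfin := hWL _ _ hGn hVn
  rw [hWV] at hfin
  have e2 : (l + t)⁻¹ • W ((l + t) • G w) - y = (l + t)⁻¹ • (W ((l + t) • G w) - (l + t) • y) := by
    rw [smul_sub, smul_smul, inv_mul_cancel₀ hlt0.ne', one_smul]
  have e3 : (l + t) • G w - V ((l + t) • y) = (l + t) • (G w - (l + t)⁻¹ • V ((l + t) • y)) := by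
    rw [smul_sub, smul_smul, mul_inv_cancel₀ hlt0.ne', one_smul]
  rw [e2, norm_smul, norm_inv, Real.norm_eq_abs, abs_of_pos hlt0]
  rw [e3, norm_smul, Real.norm_eq_abs, abs_of_pos hlt0] at hfin
  rw [inv_mul_le_iff₀ hlt0]
  calc _ ≤ _ := hfin
    _ ≤ C2 * ((l + t) * (t * (q * e1 + e1))) := by gcongr
    _ = _ := by ring

lemma chain (J : Z →L[ℝ] Z) {W : Z → Z} (P : Z →L[ℝ] Z) (R l0 t0 c : ℝ) (hl0 : l0 < 1)
    (hl00 : 0 < l0) (ht0 : 0 < t0) (hc0 : 0 ≤ c) (hc : c ≤ 1 / 2)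
    (hstep : ∀ t, 0 < t → t ≤ t0 → ∀ l, l0 ≤ l → l + t ≤ 1 → ∃ G : Z → Z, SD J G ∧ QF P G ∧
      ∀ w, P w = w → ‖l⁻¹ • W (l • w)‖ ≤ R + 1 →
        ‖(l + t)⁻¹ • W ((l + t) • G w) - l⁻¹ • W (l • w)‖ ≤ t * c) :
    ∃ G : Z → Z, SD J G ∧ QF P G ∧ ∀ w, P w = w → ‖l0⁻¹ • W (l0 • w)‖ ≤ R + 1 / 2 →
      ‖W (G w) - l0⁻¹ • W (l0 • w)‖ ≤ c := by
  obtain ⟨n, hn⟩ := exists_nat_gt ((1 - l0) / t0)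
  have hnpos : (0 : ℝ) < n := lt_trans (by apply div_pos <;> linarith) hn
  set t := (1 - l0) / n with ht
  have htpos : 0 < t := by apply div_pos <;> linarith
  have htt : t ≤ t0 := by
    rw [ht, div_le_iff₀ hnpos]
    rw [div_lt_iff₀ ht0] at hn
    linarith
  have hnt : n * t = 1 - l0 := by rw [ht]; field_simp
  have key : ∀ k : ℕ, k ≤ n → ∃ G : Z → Z, SD J G ∧ QF P G ∧ ∀ w, P w = w →
      ‖l0⁻¹ • W (l0 • w)‖ ≤ R + 1 / 2 →
      ‖(l0 + k * t)⁻¹ • W ((l0 + k * t) • G w) - l0⁻¹ • W (l0 • w)‖ ≤ k * t * c := by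
    intro k
    induction k with
    | zero =>
      intro _
      refine ⟨fun x => x, SD.id J, ⟨fun x c _ => rfl, fun x => by simp⟩, fun w _ _ => ?_⟩
      simp
    | succ k ih =>
      intro hk
      obtain ⟨G, h1, h2, h3⟩ := ih (by omega)
      have hkn : ((k : ℝ) + 1) * t ≤ n * t := by
        have : ((k : ℝ) + 1) ≤ n := by exact_mod_cast hk
        gcongr
      have hk0 : 0 ≤ (k : ℝ) * t := by positivity
      obtain ⟨G', g1, g2, g3⟩ := hstep t htpos htt (l0 + k * t) (by linarith) (by linarith)
      refine ⟨fun x => G' (G x), g1.comp h1, g2.comp h2, fun w hw hwR => ?_⟩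
      have a1 := h3 w hw hwR
      have a2 : ‖(l0 + k * t)⁻¹ • W ((l0 + k * t) • G w)‖ ≤ R + 1 := by
        have b1 : (k : ℝ) * t * c ≤ 1 * (1/2) := by
          gcongr; linarith
        calc _ = ‖l0⁻¹ • W (l0 • w) + ((l0 + k * t)⁻¹ • W ((l0 + k * t) • G w) - l0⁻¹ • W (l0 • w))‖ := by
              congr 1; abel
          _ ≤ _ := norm_add_le _ _
          _ ≤ R + 1 := by linarith
      have a3 := g3 (G w) (h2.mem hw) a2
      have e1 : l0 + ((k + 1 : ℕ) : ℝ) * t = l0 + k * t + t := by push_cast; ring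
      rw [e1]
      calc _ = ‖((l0 + k * t + t)⁻¹ • W ((l0 + k * t + t) • G' (G w)) - (l0 + k * t)⁻¹ • W ((l0 + k * t) • G w))
            + ((l0 + k * t)⁻¹ • W ((l0 + k * t) • G w) - l0⁻¹ • W (l0 • w))‖ := by congr 1; abel
        _ ≤ _ := norm_add_le _ _
        _ ≤ t * c + k * t * c := add_le_add a3 a1
        _ = _ := by push_cast; ring
  obtain ⟨G, h1, h2, h3⟩ := key n le_rfl
  refine ⟨G, h1, h2, fun w hw hwR => ?_⟩
  have := h3 w hw hwR
  rw [hnt] at this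
  have e1 : l0 + (1 - l0) = 1 := by ring
  rw [e1, inv_one, one_smul, one_smul] at this
  refine this.trans ?_
  nlinarith

lemma inv_fderiv {V W : Z → Z} (hV : ContDiff ℝ 1 V) (hW : ContDiff ℝ 1 W)
    (hWV : ∀ x, W (V x) = x) (x ξ : Z) : fderiv ℝ W (V x) (fderiv ℝ V x ξ) = ξ := by
  have h1 : HasFDerivAt (fun y => W (V y)) ((fderiv ℝ W (V x)).comp (fderiv ℝ V x)) x :=
    ((hW.differentiable one_ne_zero) _).hasFDerivAt.comp x
      ((hV.differentiable one_ne_zero) x).hasFDerivAt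
  have h2 : (fun y => W (V y)) = id := funext hWV
  rw [h2] at h1
  have h3 := h1.unique (hasFDerivAt_id x)
  have h4 := congrArg (fun X : Z →L[ℝ] Z => X ξ) h3
  simpa using h4

lemma deriv_small {V : Z → Z} (hV : ContDiff ℝ 1 V) (P : Z →L[ℝ] Z) (ρ δ : ℝ) (hδ : 0 ≤ δ)
    (h : ∀ a b, ‖a‖ ≤ ρ → ‖b‖ ≤ ρ →
      ‖((V a - a) - (V b - b)) - P ((V a - a) - (V b - b))‖ ≤ δ * ‖a - b‖)
    (x : Z) (hx : ‖x‖ < ρ) (ξ : Z) :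
    ‖(fderiv ℝ V x ξ - ξ) - P (fderiv ℝ V x ξ - ξ)‖ ≤ δ * ‖ξ‖ := by
  have h0 : HasFDerivAt (fun y => V y - y) (fderiv ℝ V x - ContinuousLinearMap.id ℝ Z) x :=
    ((hV.differentiable one_ne_zero) x).hasFDerivAt.sub (hasFDerivAt_id x)
  have h1 : HasFDerivAt (fun y => (V y - y) - P (V y - y))
      ((fderiv ℝ V x - ContinuousLinearMap.id ℝ Z) - P.comp (fderiv ℝ V x - ContinuousLinearMap.id ℝ Z)) x :=
    h0.sub (P.hasFDerivAt.comp x h0)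
  have h2 := h1.le_of_lip' hδ (by
    have : Metric.ball (0 : Z) ρ ∈ nhds x := Metric.isOpen_ball.mem_nhds (by simpa using hx)
    filter_upwards [this] with y hy
    have hy' : ‖y‖ < ρ := by simpa using hy
    have := h y x hy'.le hx.le
    refine le_trans (le_of_eq ?_) this
    congr 1
    simp only [map_sub]
    abel)
  have h3 := ContinuousLinearMap.le_of_opNorm_le _ h2 ξ
  simpa using h3

lemma adj_small (J : Z →L[ℝ] Z) (hJn : ∀ x, ‖J x‖ = ‖x‖)
    {V W : Z → Z} (hV : ContDiff ℝ 1 V) (hW : ContDiff ℝ 1 W)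
    (hVW : ∀ x, V (W x) = x) (hWV : ∀ x, W (V x) = x)
    (hsy : ∀ z ξ η, ⟪J (fderiv ℝ V z ξ), fderiv ℝ V z η⟫ = ⟪J ξ, η⟫)
    (P : Z →L[ℝ] Z) (hPs : ∀ x y, ⟪P x, y⟫ = ⟪x, P y⟫) (hPJ : ∀ x, P (J x) = J (P x))
    (δ : ℝ) (x : Z)
    (h : ∀ ξ, ‖(fderiv ℝ W (V x) ξ - ξ) - P (fderiv ℝ W (V x) ξ - ξ)‖ ≤ δ * ‖ξ‖) (ξ : Z) :
    ‖fderiv ℝ V x (ξ - P ξ) - (ξ - P ξ)‖ ≤ δ * ‖ξ‖ := by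
  set q := fderiv ℝ V x (ξ - P ξ) - (ξ - P ξ) with hq
  have key : ∀ η, ⟪J q, η⟫ = ⟪J ξ, (fderiv ℝ W (V x) η - η) - P (fderiv ℝ W (V x) η - η)⟫ := by
    intro η
    have h1 : ⟪J (fderiv ℝ V x (ξ - P ξ)), η⟫ = ⟪J (ξ - P ξ), fderiv ℝ W (V x) η⟫ := by
      have := inv_fderiv hW hV hVW (V x) η
      rw [hWV] at this
      rw [← hsy x (ξ - P ξ) (fderiv ℝ W (V x) η), this]
    rw [hq, map_sub, inner_sub_left, h1, ← inner_sub_right, map_sub, ← hPJ, inner_sub_left, hPs,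
      ← inner_sub_right]
  have h1 := key (J q)
  have h2 := real_inner_le_norm (J ξ) ((fderiv ℝ W (V x) (J q) - J q) - P (fderiv ℝ W (V x) (J q) - J q))
  rw [← h1, real_inner_self_eq_norm_sq, hJn, hJn] at h2
  have h3 := h (J q)
  rw [hJn] at h3
  have h4 : ‖q‖ ^ 2 ≤ ‖ξ‖ * (δ * ‖q‖) := h2.trans (by gcongr)
  rcases (norm_nonneg q).eq_or_lt with h5 | h5
  · rw [← h5]
    have h6 := (norm_nonneg _).trans (h ξ)
    exact h6
  · have : ‖q‖ * ‖q‖ ≤ (δ * ‖ξ‖) * ‖q‖ := by nlinarith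
    exact le_of_mul_le_mul_right this h5

lemma kappa_small {V : Z → Z} (hV : ContDiff ℝ 1 V) (P : Z →L[ℝ] Z) (hPP : ∀ x, P (P x) = P x)
    (hPn : ∀ x, ‖P x‖ ≤ ‖x‖) (δ R : ℝ) (hδ : 0 ≤ δ)
    (h : ∀ x, ‖x‖ ≤ R → ∀ ξ, ‖fderiv ℝ V x (ξ - P ξ) - (ξ - P ξ)‖ ≤ δ * ‖ξ‖)
    (u : Z) (hu : ‖u‖ ≤ R) : ‖V u - (u - P u) - V (P u)‖ ≤ δ * ‖u‖ := by
  have hmv := norm_image_sub_le_of_norm_deriv_le_segment_01'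
    (f := fun s : ℝ => V (P u + s • (u - P u)) - s • (u - P u))
    (f' := fun s => fderiv ℝ V (P u + s • (u - P u)) (u - P u) - (u - P u)) (C := δ * ‖u‖) ?_ ?_
  · refine le_trans (le_of_eq ?_) hmv
    congr 1
    simp
  · intro s _
    refine HasDerivAt.hasDerivWithinAt ?_
    have h2 : HasDerivAt (fun s : ℝ => s • (u - P u)) (u - P u) s := by
      simpa using (hasDerivAt_id s).smul_const (u - P u)
    have h3 : HasDerivAt (fun s : ℝ => P u + s • (u - P u)) (u - P u) s := h2.const_add _
    exact (((hV.differentiable one_ne_zero) _).hasFDerivAt.comp_hasDerivAt s h3).sub h2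
  · intro s hs
    have h1 : ‖P u + s • (u - P u)‖ ≤ R := by
      have : P u + s • (u - P u) = (1 - s) • P u + s • u := by
        rw [smul_sub, sub_smul, one_smul]; abel
      rw [this]
      calc _ ≤ ‖(1 - s) • P u‖ + ‖s • u‖ := norm_add_le _ _
        _ = (1 - s) * ‖P u‖ + s * ‖u‖ := by
          rw [norm_smul, norm_smul, Real.norm_eq_abs, Real.norm_eq_abs, abs_of_nonneg hs.1,
            abs_of_nonneg (by linarith [hs.2])]
        _ ≤ (1 - s) * ‖u‖ + s * ‖u‖ := by
          have := hPn u
          have := hs.2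
          gcongr
        _ ≤ R := by linarith
    have h2 := h _ h1 (u - P u)
    have h3 : u - P u - P (u - P u) = u - P u := by rw [map_sub, hPP]; simp
    rw [h3] at h2
    have h4 := h _ h1 u
    exact h4

lemma grad_f (J : Z →L[ℝ] Z) (hJ2 : ∀ x, J (J x) = -x)
    {V W : Z → Z} (hV : ContDiff ℝ 1 V) (hW : ContDiff ℝ 1 W)
    (hVW : ∀ x, V (W x) = x)
    (hsy : ∀ z ξ η, ⟪J (fderiv ℝ V z ξ), fderiv ℝ V z η⟫ = ⟪J ξ, η⟫)
    (s : Z → ℝ) (hs1 : Differentiable ℝ s)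
    (hs : ∀ x ξ, fderiv ℝ s x ξ = ⟪J (V x), fderiv ℝ V x ξ⟫ - ⟪J x, ξ⟫) :
    ContDiff ℝ 1 (fun z => s (W z)) ∧
      ∀ z, J (gradient (fun z => s (W z)) z) = fderiv ℝ V (W z) (W z) - z := by
  have hs2 : ContDiff ℝ 1 s := by
    rw [contDiff_one_iff_fderiv]
    refine ⟨hs1, ?_⟩
    have : fderiv ℝ s = fun x => (innerSL ℝ (J (V x))).comp (fderiv ℝ V x) - innerSL ℝ (J x) := by
      ext x ξ
      rw [hs]; simp
    rw [this]
    have h1 : Continuous (fderiv ℝ V) := hV.continuous_fderiv one_ne_zero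
    have h2 := hV.continuous
    refine Continuous.sub ?_ ((innerSL ℝ).continuous.comp J.continuous)
    exact ((innerSL ℝ).continuous.comp (J.continuous.comp h2)).clm_comp h1
  refine ⟨hs2.comp hW, fun z => ?_⟩
  have hg : gradient (fun z => s (W z)) z = J (z - fderiv ℝ V (W z) (W z)) := by
    refine ext_inner_right ℝ fun ζ => ?_
    have h1 : ⟪gradient (fun z => s (W z)) z, ζ⟫ = fderiv ℝ (fun z => s (W z)) z ζ :=
      InnerProductSpace.toDual_symm_apply
    have h2 : HasFDerivAt (fun z => s (W z)) ((fderiv ℝ s (W z)).comp (fderiv ℝ W z)) z :=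
      (hs1 _).hasFDerivAt.comp z ((hW.differentiable one_ne_zero) z).hasFDerivAt
    have h3 := inv_fderiv hW hV hVW z ζ
    rw [h1, h2.fderiv, ContinuousLinearMap.comp_apply, hs, h3, hVW, ← hsy (W z) (W z), h3, map_sub,
      inner_sub_left]
  rw [hg, hJ2, neg_sub]

set_option maxHeartbeats 1000000 in
lemma core (J : Z →L[ℝ] Z) (hJ2 : ∀ x, J (J x) = -x) (hJs : ∀ x y, ⟪J x, y⟫ = -⟪x, J y⟫)
    (hJn : ∀ x, ‖J x‖ = ‖x‖)
    {V W : Z → Z} (hV : ContDiff ℝ 1 V) (hW : ContDiff ℝ 1 W) (hVW : ∀ x, V (W x) = x)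
    (hWV : ∀ x, W (V x) = x) (hV0 : V 0 = 0)
    (hsy : ∀ z ξ η, ⟪J (fderiv ℝ V z ξ), fderiv ℝ V z η⟫ = ⟪J ξ, η⟫)
    (P : ℕ → Z →L[ℝ] Z) (hPP : ∀ N x, P N (P N x) = P N x)
    (hPs : ∀ N x y, ⟪P N x, y⟫ = ⟪x, P N y⟫) (hPJ : ∀ N x, P N (J x) = J (P N x))
    (hPn : ∀ N x, ‖P N x‖ ≤ ‖x‖)
    (hfin : ∀ N, FiniteDimensional ℝ (P N).range)
    (hLV : ∀ ρ : ℝ, ∃ C : ℝ, 0 ≤ C ∧ ∀ a b, ‖a‖ ≤ ρ → ‖b‖ ≤ ρ → ‖V a - V b‖ ≤ C * ‖a - b‖)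
    (hLW : ∀ ρ : ℝ, ∃ C : ℝ, 0 ≤ C ∧ ∀ a b, ‖a‖ ≤ ρ → ‖b‖ ≤ ρ → ‖W a - W b‖ ≤ C * ‖a - b‖)
    (hcV : ∀ ρ δ : ℝ, 0 < δ → ∃ N0, ∀ N ≥ N0, ∀ a b, ‖a‖ ≤ ρ → ‖b‖ ≤ ρ →
      ‖((V a - a) - (V b - b)) - P N ((V a - a) - (V b - b))‖ ≤ δ * ‖a - b‖)
    (hcW : ∀ ρ δ : ℝ, 0 < δ → ∃ N0, ∀ N ≥ N0, ∀ a b, ‖a‖ ≤ ρ → ‖b‖ ≤ ρ →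
      ‖((W a - a) - (W b - b)) - P N ((W a - a) - (W b - b))‖ ≤ δ * ‖a - b‖)
    (s : Z → ℝ) (hs1 : Differentiable ℝ s)
    (hs : ∀ x ξ, fderiv ℝ s x ξ = ⟪J (V x), fderiv ℝ V x ξ⟫ - ⟪J x, ξ⟫)
    (ε R : ℝ) (hε : 0 < ε) (hR : 0 < R) :
    ∃ N0, ∀ N ≥ N0, ∃ G : Z → Z, SD J G ∧ QF (P N) G ∧ ∀ u, ‖u‖ ≤ R → ‖V u - G u‖ ≤ ε := by
  obtain ⟨C1, hC1, hLV'⟩ := hLV (R + 1)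
  set K1 := C1 + 1 with hK1
  have hK1p : 0 < K1 := by linarith
  have hLV1 : ∀ a b, ‖a‖ ≤ R + 1 → ‖b‖ ≤ R + 1 → ‖V a - V b‖ ≤ K1 * ‖a - b‖ := fun a b ha hb =>
    (hLV' a b ha hb).trans (by gcongr; linarith)
  set r := K1 * (R + 1) with hr
  have hrp : 0 < r := by positivity
  have hVr : ∀ l : ℝ, 0 < l → l ≤ 1 → ∀ y, ‖y‖ ≤ R + 1 → ‖V (l • y)‖ ≤ l * r := by
    intro l hl hl1 y hy
    have e1 : ‖l • y‖ = l * ‖y‖ := by rw [norm_smul, Real.norm_eq_abs, abs_of_pos hl]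
    have h1 := hLV1 (l • y) 0 (by rw [e1]; exact (mul_le_of_le_one_left (norm_nonneg _) hl1).trans hy)
      (by rw [norm_zero]; linarith)
    rw [hV0, sub_zero, sub_zero, e1] at h1
    calc _ ≤ _ := h1
      _ ≤ K1 * (l * (R + 1)) := by gcongr
      _ = l * r := by rw [hr]; ring
  obtain ⟨C2, hC2, hWL⟩ := hLW (r + 1)
  have hW0 : W 0 = 0 := by rw [← hV0, hWV, hV0]
  -- constants
  obtain ⟨β, hβ, hβ1, hβ2⟩ : ∃ β > 0, β ≤ 1 / 4 ∧ K1 * (2 * β) ≤ ε / 2 := by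
    refine ⟨min (1/4) (ε / (4 * K1)), by positivity, min_le_left _ _, ?_⟩
    calc K1 * (2 * min (1/4) (ε / (4 * K1))) ≤ K1 * (2 * (ε / (4 * K1))) := by
          gcongr; exact min_le_right _ _
      _ = ε / 2 := by field_simp; norm_num
      _ ≤ _ := le_rfl
  obtain ⟨a, ha, ha1, ha2⟩ : ∃ a > 0, 2 * a ≤ 1 ∧ C2 * (2 * a) ≤ β := by
    refine ⟨min (1/2) (β / (2 * (C2 + 1))), by positivity, ?_, ?_⟩
    · have := min_le_left (1/2 : ℝ) (β / (2 * (C2 + 1))); linarith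
    · calc C2 * (2 * min (1/2) (β / (2 * (C2 + 1)))) ≤ (C2 + 1) * (2 * (β / (2 * (C2 + 1)))) := by
            gcongr
            · linarith
            · exact min_le_right _ _
        _ = β := by field_simp
        _ ≤ _ := le_rfl
  set L := fderiv ℝ V 0 with hL
  have hLd : HasFDerivAt V L 0 := ((hV.differentiable one_ne_zero) 0).hasFDerivAt
  obtain ⟨l0, hl0, hl01, hlin⟩ : ∃ l0 : ℝ, 0 < l0 ∧ l0 < 1 ∧ ∀ v, ‖v‖ ≤ R →
      ‖V (l0 • v) - l0 • L v‖ ≤ l0 * a := by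
    have h1 := (hasFDerivAt_iff_isLittleO_nhds_zero.1 hLd).def (show 0 < a / (R + 1) by positivity)
    obtain ⟨d, hd, h2⟩ := Metric.eventually_nhds_iff.1 h1
    have hm1 := min_le_left (1/2 : ℝ) (d / (2 * (R + 1)))
    have hm2 := min_le_right (1/2 : ℝ) (d / (2 * (R + 1)))
    have hm0 : 0 < min (1/2 : ℝ) (d / (2 * (R + 1))) := by positivity
    generalize min (1/2 : ℝ) (d / (2 * (R + 1))) = l at *
    refine ⟨l, hm0, by linarith, fun v hv => ?_⟩
    have e1 : ‖l • v‖ = l * ‖v‖ := by rw [norm_smul, Real.norm_eq_abs, abs_of_pos hm0]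
    have e2 : ‖l • v‖ ≤ l * (R + 1) := by rw [e1]; gcongr; linarith
    have h3 := h2 (y := l • v) (by
      rw [dist_zero_right]
      rw [le_div_iff₀ (by positivity)] at hm2
      linarith)
    rw [zero_add, hV0, sub_zero, map_smul] at h3
    calc _ ≤ _ := h3
      _ ≤ a / (R + 1) * (l * (R + 1)) := by gcongr
      _ = l * a := by field_simp
  obtain ⟨e1, he1, he1β⟩ : ∃ e1 > 0, C2 * ((l0 ^ 2)⁻¹ * e1 + e1) ≤ β := by
    refine ⟨β / ((C2 + 1) * ((l0 ^ 2)⁻¹ + 1)), by positivity, ?_⟩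
    calc _ = C2 / (C2 + 1) * β := by field_simp
      _ ≤ 1 * β := by gcongr; rw [div_le_one (by linarith)]; linarith
      _ = β := one_mul _
  obtain ⟨δl, hδl, hM⟩ := linear_approx J hJ2 hJs L (fderiv ℝ W 0)
    (by
      ext ξ
      have := inv_fderiv hW hV hVW 0 ξ
      rw [hW0] at this
      simpa using this)
    (by
      ext ξ
      have := inv_fderiv hV hW hWV 0 ξ
      rw [hV0] at this
      simpa using this) (hsy 0) (a / (R + 1)) (by positivity)
  obtain ⟨δ, hδ, hδ1, hδ2, hδ3⟩ : ∃ δ > 0, 2 * δ ≤ δl ∧ δ * R ≤ ε / 2 ∧ 2 * δ * (C2 * r) ≤ e1 / 2 := by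
    refine ⟨min (δl / 2) (min (ε / (2 * R)) (e1 / (4 * (C2 * r + 1)))), by positivity, ?_, ?_, ?_⟩
    · have := min_le_left (δl / 2) (min (ε / (2 * R)) (e1 / (4 * (C2 * r + 1))))
      linarith
    · calc _ ≤ ε / (2 * R) * R := by
            gcongr; exact (min_le_right _ _).trans (min_le_left _ _)
        _ = ε / 2 := by field_simp
    · have h0 : 0 ≤ C2 * r := by positivity
      calc _ ≤ 2 * (e1 / (4 * (C2 * r + 1))) * (C2 * r + 1) := by
            gcongr
            · exact (min_le_right _ _).trans (min_le_right _ _)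
            · linarith
        _ = e1 / 2 := by field_simp; norm_num
        _ ≤ _ := le_rfl
  obtain ⟨NV, hNV⟩ := hcV (R + C2 * r + 1) δ hδ
  obtain ⟨NW, hNW⟩ := hcW (r + 1) δ hδ
  refine ⟨max NV NW, fun N hN => ?_⟩
  have hDV := deriv_small hV (P N) _ δ hδ.le (hNV N ((le_max_left _ _).trans hN))
  have hDW := deriv_small hW (P N) _ δ hδ.le (hNW N ((le_max_right _ _).trans hN))
  have hadj : ∀ x, ‖x‖ ≤ R → ∀ ξ, ‖fderiv ℝ V x (ξ - P N ξ) - (ξ - P N ξ)‖ ≤ δ * ‖ξ‖ := by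
    intro x hx
    refine adj_small J hJn hV hW hVW hWV hsy (P N) (hPs N) (hPJ N) δ x (hDW (V x) ?_)
    have h1 := hVr 1 one_pos le_rfl x (by linarith)
    rw [one_smul] at h1
    linarith
  have hkap := kappa_small hV (P N) (hPP N) (hPn N) δ R hδ.le hadj
  have hC2r : 0 ≤ C2 * r := by positivity
  obtain ⟨M, hM1, hM2, hM3⟩ := hM (P N) (by ext x; exact hPP N x) (hPs N) (by ext x; exact hPJ N x) (by
    refine ContinuousLinearMap.opNorm_le_bound _ hδl.le fun ξ => ?_
    have h1 := hDV 0 (by rw [norm_zero]; linarith) (P N ξ)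
    have h2 := hadj 0 (by rw [norm_zero]; linarith) ξ
    have h3 : ((L - 1) - P N * (L - 1) * P N) ξ =
        ((L (P N ξ) - P N ξ) - P N (L (P N ξ) - P N ξ)) + (L (ξ - P N ξ) - (ξ - P N ξ)) := by
      simp only [ContinuousLinearMap.sub_apply, ContinuousLinearMap.mul_apply,
        ContinuousLinearMap.one_apply, map_sub]
      abel
    rw [h3]
    calc _ ≤ _ := norm_add_le _ _
      _ ≤ δ * ‖P N ξ‖ + δ * ‖ξ‖ := add_le_add h1 h2
      _ ≤ δ * ‖ξ‖ + δ * ‖ξ‖ := by gcongr; exact hPn N ξ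
      _ = 2 * δ * ‖ξ‖ := by ring
      _ ≤ _ := by gcongr)
  obtain ⟨hf1, hf2⟩ := grad_f J hJ2 hV hW hVW hsy s hs1 hs
  obtain ⟨g, hg, hsym, ⟨c, hc⟩, ⟨B, hB⟩, hP1, hP2, hgf⟩ := mollify _ hf1 (P N) (hPP N) (hPs N)
    (hfin N) r (e1 / 2) hrp (by positivity)
  have hgY : ∀ z, P N z = z → ‖z‖ ≤ r → ‖J (g z) - (fderiv ℝ V (W z) (W z) - z)‖ ≤ e1 := by
    intro z hz hzr
    have h1 := hgf z hz hzr
    have hx : ‖W z‖ ≤ C2 * r := by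
      have h2 := hWL z 0 (by linarith) (by rw [norm_zero]; linarith)
      rw [hW0, sub_zero, sub_zero] at h2
      exact h2.trans (by gcongr)
    have h3 := hDV (W z) (by linarith) (W z)
    have h4 := hNV N ((le_max_left _ _).trans hN) (W z) 0 (by linarith) (by rw [norm_zero]; linarith)
    rw [hV0, hVW] at h4
    simp only [sub_zero] at h4
    have h5 : J (g z) - (fderiv ℝ V (W z) (W z) - z) =
        J (g z - P N (gradient (fun z => s (W z)) z)) -
        (((fderiv ℝ V (W z) (W z) - W z) - P N (fderiv ℝ V (W z) (W z) - W z))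
          - ((z - W z) - P N (z - W z))) := by
      rw [map_sub J, ← hPJ, hf2]
      simp only [map_sub]
      abel
    rw [h5]
    calc _ ≤ _ := norm_sub_le _ _
      _ ≤ e1 / 2 + (δ * ‖W z‖ + δ * ‖W z‖) := by
        refine add_le_add (by rw [hJn]; exact h1) ((norm_sub_le _ _).trans (add_le_add h3 h4))
      _ = e1 / 2 + 2 * δ * ‖W z‖ := by ring
      _ ≤ e1 / 2 + 2 * δ * (C2 * r) := by gcongr
      _ ≤ e1 := by linarith
  obtain ⟨t0, ht0, hst⟩ := step J hJ2 hJs hJn hV hW.continuous hVW hWV (P N) (hPP N) (hfin N) R r C2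
    hrp hC2 hVr hWL l0 e1 hl0 he1 hg hsym hc hB hP1 (fun x => by rw [hPJ, hP2]) hgY
  obtain ⟨G, hG1, hG2, hG3⟩ := chain J (P N) R l0 t0 _ hl01 hl0 ht0 (by positivity)
    (he1β.trans (by linarith)) hst
  refine ⟨fun x => G (M x), hG1.comp hM1, hG2.comp hM2, fun u hu => ?_⟩
  have hQF := hG2.comp hM2
  set v := P N u with hv
  have hvP : P N v = v := hPP N u
  have hvR : ‖v‖ ≤ R := (hPn N u).trans hu
  have hGu : G (M u) = G (M v) + (u - v) := by
    have := hQF.1 v (u - v) (by rw [map_sub, hvP, sub_eq_zero])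
    rwa [add_sub_cancel] at this
  have hMv : P N (M v) = M v := hM2.mem hvP
  have hMVv : ‖l0 • M v - V (l0 • v)‖ ≤ l0 * (2 * a) := by
    have h1 : ‖M v - L v‖ ≤ a := by
      have h2 := ContinuousLinearMap.le_of_opNorm_le _ hM3 v
      rw [ContinuousLinearMap.sub_apply] at h2
      calc _ ≤ _ := h2
        _ ≤ a / (R + 1) * (R + 1) := by gcongr; linarith
        _ = a := by field_simp
    calc _ = ‖l0 • (M v - L v) - (V (l0 • v) - l0 • L v)‖ := by rw [smul_sub]; congr 1; abel
      _ ≤ _ := norm_sub_le _ _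
      _ ≤ l0 * a + l0 * a := by
        refine add_le_add ?_ (hlin v hvR)
        rw [norm_smul, Real.norm_eq_abs, abs_of_pos hl0]
        gcongr
      _ = _ := by ring
  have hVv := hVr l0 hl0 hl01.le v (by linarith)
  have hVv' : ‖V (l0 • v)‖ ≤ r := hVv.trans (mul_le_of_le_one_left hrp.le hl01.le)
  have hMn : ‖l0 • M v‖ ≤ r + 1 := by
    calc _ = ‖V (l0 • v) + (l0 • M v - V (l0 • v))‖ := by congr 1; abel
      _ ≤ _ := norm_add_le _ _
      _ ≤ r + l0 * (2 * a) := add_le_add hVv' hMVv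
      _ ≤ r + 1 * 1 := by gcongr
      _ = _ := by ring
  have hWM : ‖l0⁻¹ • W (l0 • M v) - v‖ ≤ β := by
    have h1 := hWL _ _ hMn (by linarith : ‖V (l0 • v)‖ ≤ r + 1)
    rw [hWV] at h1
    have h2 : l0⁻¹ • W (l0 • M v) - v = l0⁻¹ • (W (l0 • M v) - l0 • v) := by
      rw [smul_sub, smul_smul, inv_mul_cancel₀ hl0.ne', one_smul]
    rw [h2, norm_smul, norm_inv, Real.norm_eq_abs, abs_of_pos hl0, inv_mul_le_iff₀ hl0]
    calc _ ≤ _ := h1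
      _ ≤ C2 * (l0 * (2 * a)) := by gcongr
      _ = l0 * (C2 * (2 * a)) := by ring
      _ ≤ _ := by gcongr
  have hch := hG3 (M v) hMv (by
    calc _ = ‖v + (l0⁻¹ • W (l0 • M v) - v)‖ := by congr 1; abel
      _ ≤ _ := norm_add_le _ _
      _ ≤ R + 1 / 2 := by linarith)
  have hWG : ‖W (G (M v)) - v‖ ≤ 2 * β := by
    calc _ = ‖(W (G (M v)) - l0⁻¹ • W (l0 • M v)) + (l0⁻¹ • W (l0 • M v) - v)‖ := by congr 1; abel
      _ ≤ _ := norm_add_le _ _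
      _ ≤ 2 * β := by linarith
  have hWGn : ‖W (G (M v))‖ ≤ R + 1 := by
    calc _ = ‖v + (W (G (M v)) - v)‖ := by congr 1; abel
      _ ≤ _ := norm_add_le _ _
      _ ≤ R + 1 := by linarith
  have hfinal := hLV1 _ v hWGn (by linarith)
  rw [hVW] at hfinal
  have hk := hkap u hu
  rw [← hv] at hk
  calc ‖V u - G (M u)‖ = ‖(V u - (u - v) - V v) - (G (M v) - V v)‖ := by rw [hGu]; congr 1; abel
    _ ≤ _ := norm_sub_le _ _
    _ ≤ δ * R + K1 * (2 * β) := by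
      refine add_le_add (hk.trans (by gcongr)) (hfinal.trans (by gcongr))
    _ ≤ ε := by linarith

lemma unif_taylor {F : Type*} [NormedAddCommGroup F] [NormedSpace ℝ F] {G : Z → F}
    (hG : ContDiff ℝ 1 G) (K : Set Z) (hK : IsCompact K) (e : ℝ) (he : 0 < e) :
    ∃ d > 0, ∀ z ∈ K, ∀ z', ‖z' - z‖ < d →
      ‖G z' - G z - fderiv ℝ G z (z' - z)‖ ≤ e * ‖z' - z‖ := by
  have hc : Continuous (fderiv ℝ G) := hG.continuous_fderiv one_ne_zero
  have h1 := hK.uniformContinuousAt_of_continuousAt (fderiv ℝ G) (fun z _ => hc.continuousAt)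
    (Metric.dist_mem_uniformity he)
  obtain ⟨d, hd, h2⟩ := Metric.mem_uniformity_dist.1 h1
  refine ⟨d, hd, fun z hz z' hz' => ?_⟩
  refine Convex.norm_image_sub_le_of_norm_fderiv_le' (s := Metric.ball z d)
    (fun x _ => (hG.differentiable one_ne_zero) x) (fun x hx => ?_) (convex_ball z d)
    (Metric.mem_ball_self hd) (by rwa [mem_ball_iff_norm])
  have h3 := h2 (a := z) (b := x) (by rwa [dist_comm]) hz
  have h4 : dist (fderiv ℝ G z) (fderiv ℝ G x) < e := h3
  rw [dist_comm, dist_eq_norm] at h4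
  exact h4.le

lemma growth {F : Type*} [NormedAddCommGroup F] [NormedSpace ℝ F] {E E' : ℝ → F}
    (hE : ∀ t, HasDerivAt E (E' t) t) (T k : ℝ) (hk : ∀ t, |t| ≤ |T| → ‖E' t‖ ≤ k) :
    ‖E T - E 0‖ ≤ k * |T| := by
  have := Convex.norm_image_sub_le_of_norm_hasDerivWithin_le (f := E) (f' := E')
    (s := Set.Icc (-|T|) |T|) (x := 0) (y := T) (C := k)
    (fun t _ => (hE t).hasDerivWithinAt) (fun t ht => hk t (abs_le.2 ht)) (convex_Icc _ _)
    ⟨by simp, by simp⟩ (abs_le.1 le_rfl)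
  simpa using this

lemma flow_taylor {F : Type*} [NormedAddCommGroup F] [NormedSpace ℝ F] {G : Z → F}
    (hG : ContDiff ℝ 1 G) {X : Z → Z} (Φ : ℝ → Z → Z)
    (hode : ∀ z t, HasDerivAt (fun τ => Φ τ z) (X (Φ t z)) t)
    (T C : ℝ) (a : Z) (hC : 0 ≤ C)
    (hL : ∀ τ, |τ| ≤ |T| → ∀ b, ‖b - a‖ ≤ 1 → ‖Φ τ b - Φ τ a‖ ≤ C * ‖b - a‖)
    (e : ℝ) (he : 0 < e) :
    ∃ d > 0, ∀ b, ‖b - a‖ < d → ∀ τ, |τ| ≤ |T| →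
      ‖G (Φ τ b) - G (Φ τ a) - fderiv ℝ G (Φ τ a) (Φ τ b - Φ τ a)‖ ≤ e * (C * ‖b - a‖) := by
  have hcont : Continuous (fun τ => Φ τ a) :=
    continuous_iff_continuousAt.2 fun t => (hode a t).continuousAt
  let K := (fun τ => Φ τ a) '' Set.Icc (-|T|) |T|
  have hK : IsCompact K := isCompact_Icc.image hcont
  obtain ⟨d, hd, h⟩ := unif_taylor hG K hK e he
  refine ⟨min 1 (d / (C + 1)), by positivity, fun b hb τ hτ => ?_⟩
  have hb1 : ‖b - a‖ < 1 := hb.trans_le (min_le_left _ _)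
  have hb2 : ‖b - a‖ < d / (C + 1) := hb.trans_le (min_le_right _ _)
  have h1 := hL τ hτ b hb1.le
  rw [lt_div_iff₀ (by linarith)] at hb2
  have h2 := h (Φ τ a) ⟨τ, abs_le.1 hτ, rfl⟩ (Φ τ b) (by nlinarith [norm_nonneg (b - a)])
  exact h2.trans (by gcongr)

lemma flow_symplectic (J : Z →L[ℝ] Z) (hJn : ∀ x, ‖J x‖ = ‖x‖)
    {X : Z → Z} (hX : ContDiff ℝ 1 X) (Φ : ℝ → Z → Z)
    (h0 : ∀ z, Φ 0 z = z)
    (hode : ∀ z t, HasDerivAt (fun τ => Φ τ z) (X (Φ t z)) t)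
    (hC1 : ∀ t, ContDiff ℝ 1 (Φ t))
    (hH : ∀ z u v, ⟪J (fderiv ℝ X z u), v⟫ + ⟪J u, fderiv ℝ X z v⟫ = 0)
    (T : ℝ) (hL : ∀ a : Z, ∃ C : ℝ, 0 ≤ C ∧ ∀ τ, |τ| ≤ |T| → ∀ b, ‖b - a‖ ≤ 1 →
      ‖Φ τ b - Φ τ a‖ ≤ C * ‖b - a‖) (x ξ η : Z) :
    ⟪J (fderiv ℝ (Φ T) x ξ), fderiv ℝ (Φ T) x η⟫ = ⟪J ξ, η⟫ := by
  obtain ⟨C, hC, hLx⟩ := hL x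
  -- difference quotients
  have hquo : ∀ ζ : Z, Filter.Tendsto (fun s : ℝ => s⁻¹ • (Φ T (x + s • ζ) - Φ T x))
      (nhdsWithin 0 {0}ᶜ) (nhds (fderiv ℝ (Φ T) x ζ)) := by
    intro ζ
    have h2 : HasDerivAt (fun s : ℝ => x + s • ζ) ζ 0 := by
      simpa using ((hasDerivAt_id (0:ℝ)).smul_const ζ).const_add x
    have h3 : HasDerivAt (fun s : ℝ => Φ T (x + s • ζ)) (fderiv ℝ (Φ T) x ζ) 0 := by
      have h4 : HasFDerivAt (Φ T) (fderiv ℝ (Φ T) x) (x + (0:ℝ) • ζ) := by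
        rw [zero_smul, add_zero]
        exact (((hC1 T).differentiable one_ne_zero) x).hasFDerivAt
      exact h4.comp_hasDerivAt 0 h2
    have h5 := h3.tendsto_slope_zero
    simpa using h5
  have hlim := ((J.continuous.tendsto _).comp (hquo ξ)).inner (𝕜 := ℝ) (hquo η)
  refine tendsto_nhds_unique hlim ?_
  rw [Metric.tendsto_nhdsWithin_nhds]
  intro e he
  set M := C * ‖ξ‖ * (C * ‖η‖) * |T| + C * ‖η‖ * (C * ‖ξ‖) * |T| + 1 with hM
  have hMp : 0 < M := by positivity
  obtain ⟨d, hd, ht⟩ := flow_taylor hX Φ hode T C x hC hLx (e / (2 * M)) (by positivity)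
  refine ⟨min (d / (‖ξ‖ + ‖η‖ + 1)) (1 / (‖ξ‖ + ‖η‖ + 1)), by positivity, fun s hs0 hs => ?_⟩
  have hs0' : s ≠ 0 := hs0
  rw [dist_zero_right, Real.norm_eq_abs] at hs
  have hs1 := hs.trans_le (min_le_left _ _)
  have hs2 := hs.trans_le (min_le_right _ _)
  have hsp : 0 < |s| := abs_pos.2 hs0'
  rw [lt_div_iff₀ (by positivity)] at hs1 hs2
  have hbn : ∀ ζ : Z, ‖x + s • ζ - x‖ = |s| * ‖ζ‖ := fun ζ => by
    rw [add_sub_cancel_left, norm_smul, Real.norm_eq_abs]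
  have aux : ∀ ζ : Z, ‖ζ‖ ≤ ‖ξ‖ + ‖η‖ → (∀ τ, |τ| ≤ |T| → ‖Φ τ (x + s • ζ) - Φ τ x‖ ≤ C * (|s| * ‖ζ‖)) ∧
      (∀ τ, |τ| ≤ |T| → ‖X (Φ τ (x + s • ζ)) - X (Φ τ x) - fderiv ℝ X (Φ τ x) (Φ τ (x + s • ζ) - Φ τ x)‖
        ≤ e / (2 * M) * (C * (|s| * ‖ζ‖))) := by
    intro ζ hζ
    have hle : |s| * ‖ζ‖ ≤ |s| * (‖ξ‖ + ‖η‖ + 1) := by gcongr; linarith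
    refine ⟨fun τ hτ => ?_, fun τ hτ => ?_⟩
    · have := hLx τ hτ (x + s • ζ) (by rw [hbn]; linarith)
      rwa [hbn] at this
    · have := ht (x + s • ζ) (by rw [hbn]; linarith) τ hτ
      rwa [hbn] at this
  obtain ⟨a1, a2⟩ := aux ξ (by linarith [norm_nonneg η])
  obtain ⟨b1, b2⟩ := aux η (by linarith [norm_nonneg ξ])
  have hder : ∀ t, HasDerivAt (fun τ => ⟪J (Φ τ (x + s • ξ) - Φ τ x), Φ τ (x + s • η) - Φ τ x⟫)
      (⟪J (Φ t (x + s • ξ) - Φ t x), X (Φ t (x + s • η)) - X (Φ t x)⟫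
        + ⟪J (X (Φ t (x + s • ξ)) - X (Φ t x)), Φ t (x + s • η) - Φ t x⟫) t := by
    intro t
    have h1 := J.hasFDerivAt.comp_hasDerivAt t ((hode (x + s • ξ) t).sub (hode x t))
    exact HasDerivAt.inner ℝ h1 ((hode (x + s • η) t).sub (hode x t))
  have hgr := growth hder T (e / (2 * M) * (|s| * |s| * (C * ‖ξ‖ * (C * ‖η‖) + C * ‖η‖ * (C * ‖ξ‖)))) (by
    intro t ht
    set D := Φ t (x + s • ξ) - Φ t x with hD
    set D' := Φ t (x + s • η) - Φ t x with hD'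
    have hz := hH (Φ t x) D D'
    have e1 : ⟪J D, X (Φ t (x + s • η)) - X (Φ t x)⟫ + ⟪J (X (Φ t (x + s • ξ)) - X (Φ t x)), D'⟫
        = ⟪J D, X (Φ t (x + s • η)) - X (Φ t x) - fderiv ℝ X (Φ t x) D'⟫
          + ⟪J (X (Φ t (x + s • ξ)) - X (Φ t x) - fderiv ℝ X (Φ t x) D), D'⟫ := by
      rw [inner_sub_right _ _ (fderiv ℝ X (Φ t x) D'), map_sub J _ (fderiv ℝ X (Φ t x) D),
        inner_sub_left]
      linarith
    rw [e1]
    have c1 := a1 t ht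
    have c2 := a2 t ht
    have c3 := b1 t ht
    have c4 := b2 t ht
    calc _ ≤ _ := norm_add_le _ _
      _ ≤ ‖J D‖ * _ + ‖J _‖ * ‖D'‖ := add_le_add (norm_inner_le_norm _ _) (norm_inner_le_norm _ _)
      _ ≤ (C * (|s| * ‖ξ‖)) * (e / (2 * M) * (C * (|s| * ‖η‖)))
          + (e / (2 * M) * (C * (|s| * ‖ξ‖))) * (C * (|s| * ‖η‖)) := by
        rw [hJn, hJn]
        gcongr
      _ = _ := by ring)
  simp only [h0, add_sub_cancel_left] at hgr
  rw [dist_eq_norm]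
  have e2 : ⟪J (s⁻¹ • (Φ T (x + s • ξ) - Φ T x)), s⁻¹ • (Φ T (x + s • η) - Φ T x)⟫ - ⟪J ξ, η⟫
      = (s * s)⁻¹ * (⟪J (Φ T (x + s • ξ) - Φ T x), Φ T (x + s • η) - Φ T x⟫ - ⟪J (s • ξ), s • η⟫) := by
    rw [map_smul, map_smul, real_inner_smul_left, real_inner_smul_right, real_inner_smul_left,
      real_inner_smul_right]
    field_simp
  simp only [Function.comp]
  rw [e2, norm_mul, norm_inv, norm_mul, Real.norm_eq_abs s]
  rw [inv_mul_lt_iff₀ (by positivity)]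
  calc _ ≤ _ := hgr
    _ = (|s| * |s|) * (e / (2 * M) * (C * ‖ξ‖ * (C * ‖η‖) * |T| + C * ‖η‖ * (C * ‖ξ‖) * |T|)) := by ring
    _ ≤ (|s| * |s|) * (e / (2 * M) * M) := by gcongr; linarith
    _ = (|s| * |s|) * (e / 2) := by field_simp
    _ < (|s| * |s|) * e := by gcongr; linarith

lemma flow_action (J : Z →L[ℝ] Z)
    {X : Z → Z} (hX : ContDiff ℝ 1 X) (Φ : ℝ → Z → Z)
    (h0 : ∀ z, Φ 0 z = z)
    (hode : ∀ z t, HasDerivAt (fun τ => Φ τ z) (X (Φ t z)) t)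
    (hC1 : ∀ t, ContDiff ℝ 1 (Φ t))
    {p : Z → ℝ} (hp : ContDiff ℝ 1 p)
    (hpX : ∀ z u, fderiv ℝ p z u = ⟪J (X z), u⟫ + ⟪J z, fderiv ℝ X z u⟫)
    (T : ℝ) (hL : ∀ a : Z, ∃ C : ℝ, 0 ≤ C ∧ ∀ τ, |τ| ≤ |T| → ∀ b, ‖b - a‖ ≤ 1 →
      ‖Φ τ b - Φ τ a‖ ≤ C * ‖b - a‖) (x : Z) :
    HasFDerivAt (fun y => ∫ τ in (0:ℝ)..T, p (Φ τ y))
      ((innerSL ℝ (J (Φ T x))).comp (fderiv ℝ (Φ T) x) - innerSL ℝ (J x)) x := by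
  obtain ⟨C, hC, hLx⟩ := hL x
  have hcont : ∀ y, Continuous (fun τ => Φ τ y) := fun y =>
    continuous_iff_continuousAt.2 fun t => (hode y t).continuousAt
  have hcp : ∀ y, Continuous (fun τ => p (Φ τ y)) := fun y => hp.continuous.comp (hcont y)
  have hI : HasFDerivAt (fun y => (∫ τ in (0:ℝ)..T, p (Φ τ y))
      - (⟪J (Φ T x), Φ T y - Φ T x⟫ - ⟪J x, y - x⟫)) (0 : Z →L[ℝ] ℝ) x := by
    rw [hasFDerivAt_iff_isLittleO]
    rw [Asymptotics.isLittleO_iff]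
    intro e he
    -- bound for J on trajectory
    obtain ⟨B, hB⟩ := (isCompact_Icc (a := -|T|) (b := |T|)).exists_bound_of_continuousOn
      (J.continuous.comp (hcont x)).continuousOn
    have hB0 : 0 ≤ B := (norm_nonneg _).trans (hB 0 ⟨by simp, by simp⟩)
    set M := (1 + B) * C * |T| + 1 with hM
    have hMp : 0 < M := by positivity
    obtain ⟨d1, hd1, ht1⟩ := flow_taylor hX Φ hode T C x hC hLx (e / M) (by positivity)
    obtain ⟨d2, hd2, ht2⟩ := flow_taylor hp Φ hode T C x hC hLx (e / M) (by positivity)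
    filter_upwards [Metric.ball_mem_nhds x hd1, Metric.ball_mem_nhds x hd2] with y hy1 hy2
    rw [mem_ball_iff_norm] at hy1 hy2
    have hder : ∀ t, HasDerivAt (fun t => (∫ τ in (0:ℝ)..t, (p (Φ τ y) - p (Φ τ x)))
        - ⟪J (Φ t x), Φ t y - Φ t x⟫)
        ((p (Φ t y) - p (Φ t x)) - (⟪J (Φ t x), X (Φ t y) - X (Φ t x)⟫
          + ⟪J (X (Φ t x)), Φ t y - Φ t x⟫)) t := by
      intro t
      refine HasDerivAt.sub ?_ ?_
      · exact (((hcp y).sub (hcp x)).integral_hasStrictDerivAt 0 t).hasDerivAt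
      · have h1 := J.hasFDerivAt.comp_hasDerivAt t (hode x t)
        exact HasDerivAt.inner ℝ h1 ((hode y t).sub (hode x t))
    have hgr := growth hder T ((1 + B) * (e / M * (C * ‖y - x‖))) (by
      intro t ht
      have c1 := ht1 y hy1 t ht
      have c2 := ht2 y hy2 t ht
      have hq := hpX (Φ t x) (Φ t y - Φ t x)
      have e1 : (p (Φ t y) - p (Φ t x)) - (⟪J (Φ t x), X (Φ t y) - X (Φ t x)⟫
          + ⟪J (X (Φ t x)), Φ t y - Φ t x⟫) =
          (p (Φ t y) - p (Φ t x) - fderiv ℝ p (Φ t x) (Φ t y - Φ t x))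
          - ⟪J (Φ t x), X (Φ t y) - X (Φ t x) - fderiv ℝ X (Φ t x) (Φ t y - Φ t x)⟫ := by
        rw [inner_sub_right _ _ (fderiv ℝ X (Φ t x) (Φ t y - Φ t x)), hq]
        ring
      rw [e1]
      have c3 : ‖J (Φ t x)‖ ≤ B := hB t (abs_le.1 ht)
      calc _ ≤ _ := norm_sub_le _ _
        _ ≤ e / M * (C * ‖y - x‖) + B * (e / M * (C * ‖y - x‖)) := by
          refine add_le_add c2 ((norm_inner_le_norm _ _).trans ?_)
          gcongr
        _ = _ := by ring)
    rw [intervalIntegral.integral_sub ((hcp y).intervalIntegrable _ _) ((hcp x).intervalIntegrable _ _)] at hgr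
    simp only [h0, intervalIntegral.integral_same] at hgr
    calc _ = _ := by
          congr 1
          simp
          ring
      _ ≤ _ := hgr
      _ = (e / M) * ((1 + B) * C * |T|) * ‖y - x‖ := by ring
      _ ≤ (e / M) * M * ‖y - x‖ := by gcongr; linarith
      _ = e * ‖y - x‖ := by field_simp
  have hrest : HasFDerivAt (fun y => ⟪J (Φ T x), Φ T y - Φ T x⟫ - ⟪J x, y - x⟫)
      ((innerSL ℝ (J (Φ T x))).comp (fderiv ℝ (Φ T) x) - innerSL ℝ (J x)) x := by
    have h1 := (((hC1 T).differentiable one_ne_zero) x).hasFDerivAt.sub_const (Φ T x)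
    have h2 := (innerSL ℝ (J (Φ T x))).hasFDerivAt.comp x h1
    have h3 := (innerSL ℝ (J x)).hasFDerivAt.comp x ((hasFDerivAt_id x).sub_const x)
    exact h2.sub h3
  have := hI.add hrest
  rw [zero_add] at this
  refine this.congr_of_eventuallyEq (Filter.Eventually.of_forall fun y => ?_)
  simp

lemma J_sq {b : ℕ × Bool → Z} {J : Z →L[ℝ] Z} (hb : IsHilbertBasis b) (hJ : IsJ b J) :
    ∀ x, J (J x) = -x := by
  have hd : Dense (Submodule.span ℝ (Set.range b) : Set Z) :=
    (Submodule.dense_iff_topologicalClosure_eq_top).2 hb.2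
  have : J.comp J = -(ContinuousLinearMap.id ℝ Z) := by
    refine ContinuousLinearMap.ext_on hd ?_
    rintro _ ⟨⟨j, s⟩, rfl⟩
    cases s <;> simp [(hJ j).1, (hJ j).2]
  intro x
  simpa using congrArg (fun L : Z →L[ℝ] Z => L x) this

lemma J_skew {b : ℕ × Bool → Z} {J : Z →L[ℝ] Z} (hb : IsHilbertBasis b) (hJ : IsJ b J) :
    ∀ x y, ⟪J x, y⟫ = -⟪x, J y⟫ := by
  have hd : Dense (Submodule.span ℝ (Set.range b) : Set Z) :=
    (Submodule.dense_iff_topologicalClosure_eq_top).2 hb.2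
  have ho := orthonormal_iff_ite.1 hb.1
  have h1 : ∀ i k, ⟪J (b i), b k⟫ = -⟪b i, J (b k)⟫ := by
    rintro ⟨i, s⟩ ⟨k, t⟩
    cases s <;> cases t <;>
      simp [(hJ i).1, (hJ i).2, (hJ k).1, (hJ k).2, ho, inner_neg_left, inner_neg_right]
  have h2 : ∀ i y, ⟪J (b i), y⟫ = -⟪b i, J y⟫ := by
    intro i y
    have : innerSL ℝ (J (b i)) = -((innerSL ℝ (b i)).comp J) := by
      refine ContinuousLinearMap.ext_on hd ?_
      rintro _ ⟨k, rfl⟩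
      simpa using h1 i k
    simpa using congrArg (fun L : Z →L[ℝ] ℝ => L y) this
  intro x y
  have : (innerSL ℝ y).comp J = -(innerSL ℝ (J y)) := by
    refine ContinuousLinearMap.ext_on hd ?_
    rintro _ ⟨k, rfl⟩
    have := h2 k y
    rw [real_inner_comm, real_inner_comm (J y)] at this
    simpa using this
  have := congrArg (fun L : Z →L[ℝ] ℝ => L x) this
  rw [real_inner_comm, real_inner_comm (J y)]
  simpa using this

lemma J_norm {J : Z →L[ℝ] Z} (hJ2 : ∀ x, J (J x) = -x) (hJs : ∀ x y, ⟪J x, y⟫ = -⟪x, J y⟫) :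
    ∀ x, ‖J x‖ = ‖x‖ := by
  intro x
  have h1 : ⟪J x, J x⟫ = ⟪x, x⟫ := by rw [hJs, hJ2, inner_neg_right, neg_neg]
  rw [real_inner_self_eq_norm_sq, real_inner_self_eq_norm_sq] at h1
  exact (pow_left_inj₀ (norm_nonneg _) (norm_nonneg _) two_ne_zero).1 h1

/-- the projector as a continuous linear map -/
def PC (b : ℕ × Bool → Z) (N : ℕ) : Z →L[ℝ] Z :=
  ∑ i ∈ Finset.range N ×ˢ (Finset.univ : Finset Bool), (innerSL ℝ (b i)).smulRight (b i)

lemma PC_apply (b : ℕ × Bool → Z) (N : ℕ) (x : Z) :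
    PC b N x = ∑ i ∈ Finset.range N ×ˢ (Finset.univ : Finset Bool), ⟪b i, x⟫ • b i := by
  simp [PC, ContinuousLinearMap.sum_apply]

lemma PC_proj (b : ℕ × Bool → Z) (N : ℕ) (x : Z) : proj b N x = PC b N x := by
  rw [PC_apply, Finset.sum_product]
  simp [proj]

lemma PC_symm (b : ℕ × Bool → Z) (N : ℕ) (x y : Z) : ⟪PC b N x, y⟫ = ⟪x, PC b N y⟫ := by
  rw [PC_apply, PC_apply, sum_inner, inner_sum]
  refine Finset.sum_congr rfl fun i _ => ?_
  rw [real_inner_smul_left, real_inner_smul_right, real_inner_comm (b i) x, mul_comm]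

lemma PC_idem {b : ℕ × Bool → Z} (hb : Orthonormal ℝ b) (N : ℕ) (x : Z) :
    PC b N (PC b N x) = PC b N x := by
  have ho := orthonormal_iff_ite.1 hb
  rw [PC_apply b N (PC b N x), PC_apply b N x]
  refine Finset.sum_congr rfl fun i hi => ?_
  congr 1
  rw [inner_sum]
  simp only [real_inner_smul_right, ho]
  rw [Finset.sum_eq_single i]
  · simp
  · intro k _ hk
    simp [Ne.symm hk]
  · intro h; exact absurd hi h

lemma PC_norm {b : ℕ × Bool → Z} (hb : Orthonormal ℝ b) (N : ℕ) (x : Z) :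
    ‖PC b N x‖ ≤ ‖x‖ := by
  have h1 : ⟪PC b N x, PC b N x⟫ = ⟪PC b N x, x⟫ := by
    rw [PC_symm, PC_idem hb, ← PC_symm]
  have h2 := real_inner_le_norm (PC b N x) x
  rw [← h1, real_inner_self_eq_norm_sq] at h2
  by_contra hc
  push Not at hc
  nlinarith [norm_nonneg x, norm_nonneg (PC b N x)]

lemma PC_J {b : ℕ × Bool → Z} {J : Z →L[ℝ] Z} (hJ : IsJ b J)
    (hJs : ∀ x y, ⟪J x, y⟫ = -⟪x, J y⟫) (N : ℕ) (x : Z) :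
    PC b N (J x) = J (PC b N x) := by
  rw [← PC_proj, ← PC_proj, proj, proj, map_sum]
  refine Finset.sum_congr rfl fun j _ => ?_
  have h1 : ⟪b (j, true), J x⟫ = ⟪b (j, false), x⟫ := by
    have := hJs (b (j, true)) x
    rw [(hJ j).1, inner_neg_left] at this
    linarith
  have h2 : ⟪b (j, false), J x⟫ = -⟪b (j, true), x⟫ := by
    have := hJs (b (j, false)) x
    rw [(hJ j).2] at this
    linarith
  rw [h1, h2, map_add, map_smul, map_smul, (hJ j).1, (hJ j).2]
  simp [add_comm]

lemma PC_fin (b : ℕ × Bool → Z) (N : ℕ) : FiniteDimensional ℝ (PC b N).range := by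
  have hle : (PC b N).range ≤ Submodule.span ℝ
      (b '' (↑(Finset.range N ×ˢ (Finset.univ : Finset Bool)) : Set (ℕ × Bool))) := by
    rintro _ ⟨x, rfl⟩
    show PC b N x ∈ _
    rw [PC_apply]
    exact Submodule.sum_mem _ fun i hi => Submodule.smul_mem _ _
      (Submodule.subset_span ⟨i, hi, rfl⟩)
  haveI : FiniteDimensional ℝ (Submodule.span ℝ
      (b '' (↑(Finset.range N ×ˢ (Finset.univ : Finset Bool)) : Set (ℕ × Bool)))) :=
    FiniteDimensional.span_of_finite ℝ ((Finset.finite_toSet _).image _)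
  exact Submodule.finiteDimensional_of_le hle

lemma PC_tendsto {b : ℕ × Bool → Z} (hb : IsHilbertBasis b) (x : Z) :
    Filter.Tendsto (fun N => PC b N x) Filter.atTop (nhds x) := by
  let B := HilbertBasis.mk hb.1 (le_of_eq hb.2.symm)
  have hB : ∀ i, B i = b i := fun i => by simp [B]
  have hs := B.hasSum_repr x
  have ht : Filter.Tendsto (fun N : ℕ => Finset.range N ×ˢ (Finset.univ : Finset Bool))
      Filter.atTop Filter.atTop := by
    refine Filter.tendsto_atTop_finset_of_monotone ?_ ?_
    · intro m n hmn
      exact Finset.product_subset_product (Finset.range_mono hmn) (le_refl _)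
    · rintro ⟨j, s⟩
      exact ⟨j + 1, by simp⟩
  have := Filter.Tendsto.comp hs ht
  refine this.congr fun N => ?_
  rw [PC_apply]
  refine Finset.sum_congr rfl fun i _ => ?_
  have := B.repr_apply_apply x i
  rw [hB] at this
  show (B.repr x) i • B i = _
  rw [hB, this]

lemma compact_tail {E : Type*} [NormedAddCommGroup E] [NormedSpace ℝ E]
    {b : ℕ × Bool → Z} (hb : IsHilbertBasis b) (ι : E →L[ℝ] Z) (hι : IsCompactOperator ι)
    (δ : ℝ) (hδ : 0 < δ) : ∃ N0, ∀ N ≥ N0, ∀ e, ‖ι e - PC b N (ι e)‖ ≤ δ * ‖e‖ := by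
  have hK := hι.isCompact_closure_image_closedBall 1
  obtain ⟨t, -, htf, ht⟩ := hK.finite_cover_balls (show 0 < δ / 3 by positivity)
  have h1 : ∀ᶠ N in Filter.atTop, ∀ c ∈ t, ‖PC b N c - c‖ < δ / 3 := by
    rw [Filter.eventually_all_finite htf]
    intro c _
    have := Metric.tendsto_nhds.1 (PC_tendsto hb c) (δ / 3) (by positivity)
    simpa [dist_eq_norm] using this
  obtain ⟨N0, hN0⟩ := Filter.eventually_atTop.1 h1
  refine ⟨N0, fun N hN e => ?_⟩
  have hunit : ∀ e : E, ‖e‖ ≤ 1 → ‖ι e - PC b N (ι e)‖ ≤ δ := by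
    intro e he
    have hmem : ι e ∈ closure (ι '' Metric.closedBall 0 1) :=
      subset_closure ⟨e, by simpa using he, rfl⟩
    obtain ⟨c, hc, hcb⟩ := Set.mem_iUnion₂.1 (ht hmem)
    rw [Metric.mem_ball, dist_eq_norm] at hcb
    have e1 : ι e - PC b N (ι e) = (ι e - c) - PC b N (ι e - c) - (PC b N c - c) := by
      rw [map_sub]; abel
    have h2 := PC_norm hb.1 N (ι e - c)
    have h3 := hN0 N hN c hc
    rw [e1]
    have h4 := norm_sub_le ((ι e - c) - PC b N (ι e - c)) (PC b N c - c)
    have h5 := norm_sub_le (ι e - c) (PC b N (ι e - c))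
    linarith
  by_cases he : ‖e‖ = 0
  · have : e = 0 := norm_eq_zero.1 he
    simp [this]
  have hep : 0 < ‖e‖ := lt_of_le_of_ne (norm_nonneg _) (Ne.symm he)
  have := hunit (‖e‖⁻¹ • e) (by rw [norm_smul, norm_inv, norm_norm, inv_mul_cancel₀ he])
  rw [map_smul, map_smul, ← smul_sub, norm_smul, norm_inv, norm_norm, inv_mul_le_iff₀ hep] at this
  linarith

/-- `∇h` is `C¹` with symmetric derivative. -/
lemma grad_facts {h : Z → ℝ} (hh : ContDiff ℝ (⊤ : ℕ∞) h) :
    ContDiff ℝ 1 (gradient h) ∧ (∀ z u, fderiv ℝ h z u = ⟪gradient h z, u⟫) ∧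
    ∀ z u v, ⟪fderiv ℝ (gradient h) z u, v⟫ = ⟪u, fderiv ℝ (gradient h) z v⟫ := by
  have hg : gradient h = fun z => (InnerProductSpace.toDual ℝ Z).symm (fderiv ℝ h z) := rfl
  have hf : ContDiff ℝ 1 (fderiv ℝ h) := by
    refine hh.fderiv_right (m := 1) ?_
    norm_cast
  have hc : ContDiff ℝ 1 (gradient h) := by
    rw [hg]
    exact (InnerProductSpace.toDual ℝ Z).symm.toContinuousLinearEquiv.contDiff.comp hf
  have hi : ∀ z u, fderiv ℝ h z u = ⟪gradient h z, u⟫ := by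
    intro z u
    rw [hg]; simp
  refine ⟨hc, hi, ?_⟩
  have h2 : ∀ z u v, ⟪fderiv ℝ (gradient h) z u, v⟫ = fderiv ℝ (fderiv ℝ h) z u v := by
    intro z u v
    have a1 : HasFDerivAt (fun y => ⟪v, gradient h y⟫)
        ((innerSL ℝ v).comp (fderiv ℝ (gradient h) z)) z :=
      (innerSL ℝ v).hasFDerivAt.comp z (hc.differentiable one_ne_zero z).hasFDerivAt
    have a2 : HasFDerivAt (fun y => fderiv ℝ h y v)
        ((ContinuousLinearMap.apply ℝ ℝ v).comp (fderiv ℝ (fderiv ℝ h) z)) z :=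
      (ContinuousLinearMap.apply ℝ ℝ v).hasFDerivAt.comp z
        (hf.differentiable one_ne_zero z).hasFDerivAt
    have a3 : (fun y => ⟪v, gradient h y⟫) = fun y => fderiv ℝ h y v := by
      funext y; rw [hi, real_inner_comm]
    rw [a3] at a1
    have := congrArg (fun L : Z →L[ℝ] ℝ => L u) (a1.unique a2)
    rw [real_inner_comm]
    simpa using this
  intro z u v
  have hsym : IsSymmSndFDerivAt ℝ h z := by
    refine (hh.contDiffAt (x := z)).isSymmSndFDerivAt ?_
    simp only [minSmoothness_of_isRCLikeNormedField]
    exact WithTop.coe_le_coe.2 (le_top : (2 : ℕ∞) ≤ ⊤)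
  rw [h2, hsym.eq, ← h2, real_inner_comm]

/-- Approximation lemma: for each `ε > 0` and `R > 0` there are `N` and a
factorization `Φ_T = e^{TJA} ∘ (I + Φ̃_ε) ∘ (I + Φ̃_N)` on `B_R(Z)`, where both factors
`Gε = I + Φ̃_ε` and `GN = I + Φ̃_N` are symplectic diffeomorphisms, `‖Φ̃_ε(u)‖ ≤ ε` on
`GN(B_R)`, and `GN(u^N + u_N) = GN(u^N) + u_N` for `u^N ∈ Z^N`, `u_N ∈ Z_N`. -/
theorem approximation_lemma
    {Z : Type*} [NormedAddCommGroup Z] [InnerProductSpace ℝ Z] [CompleteSpace Z]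
    (b : ℕ × Bool → Z) (J : Z →L[ℝ] Z) (hb : IsHilbertBasis b) (hJ : IsJ b J)
    (A : Z →L[ℝ] Z) (hA_selfadj : ∀ x y : Z, ⟪A x, y⟫ = ⟪x, A y⟫)
    (lam : ℕ → ℝ) (hA_eig : ∀ (j : ℕ) (s : Bool), A (b (j, s)) = lam j • b (j, s))
    (h : Z → ℝ) (hh : ContDiff ℝ (⊤ : ℕ∞) h)
    -- (H1): the equation `ż = J A z + J ∇h(z)` defines a C¹-smooth global flow `Φ`
    (Φ : ℝ → Z → Z)
    (hΦ_zero : ∀ z : Z, Φ 0 z = z)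
    (hΦ_group : ∀ s t : ℝ, ∀ z : Z, Φ (s + t) z = Φ s (Φ t z))
    (hΦ_ode : ∀ (z₀ : Z) (t : ℝ),
      HasDerivAt (fun τ : ℝ => Φ τ z₀) (J (A (Φ t z₀)) + J (gradient h (Φ t z₀))) t)
    (hΦ_C1 : ∀ t : ℝ, ContDiff ℝ 1 (Φ t))
    -- (H2): the flow is uniformly bounded
    (hH2 : ∀ R T : ℝ, 0 < R → 0 < T → ∃ R' : ℝ, ∀ t : ℝ, |t| ≤ T →
      ∀ z ∈ Metric.ball (0 : Z) R, Φ t z ∈ Metric.ball (0 : Z) R')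
    -- the linear group `e^{tJA}`
    (U : ℝ → Z →L[ℝ] Z)
    (hU_zero : U 0 = ContinuousLinearMap.id ℝ Z)
    (hU_group : ∀ s t : ℝ, U (s + t) = (U s).comp (U t))
    (hU_iso : ∀ (t : ℝ) (z : Z), ‖U t z‖ = ‖z‖)
    (hU_ode : ∀ (z : Z) (t : ℝ), HasDerivAt (fun τ : ℝ => U τ z) (J (A (U t z))) t)
    -- (H3): `Φ_t = e^{tJA}(I + Φ̃_t)` with `Φ̃_t` taking values in a space `Eplus`
    -- compactly embedded in `Z`, Lipschitz from `Z` to `Eplus` on bounded sets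
    {Eplus : Type*} [NormedAddCommGroup Eplus] [NormedSpace ℝ Eplus]
    (ι : Eplus →L[ℝ] Z) (hι_inj : Function.Injective ι) (hι_cmp : IsCompactOperator ι)
    (hι_dense : DenseRange ι)
    (Ψ : ℝ → Z → Eplus)
    (hΨ : ∀ (t : ℝ) (z : Z), Φ t z = U t (z + ι (Ψ t z)))
    (hH3 : ∀ R T : ℝ, 0 < R → 0 < T → ∃ C : ℝ, ∀ t : ℝ, |t| ≤ T →
      ∀ u₀ ∈ Metric.closedBall (0 : Z) R, ∀ u₀' ∈ Metric.closedBall (0 : Z) R,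
        ‖Ψ t u₀ - Ψ t u₀'‖ ≤ C * ‖u₀ - u₀'‖)
    (T : ℝ) (ε R : ℝ) (hε : 0 < ε) (hR : 0 < R) :
    ∃ N : ℕ, ∃ GN Gε : Z → Z,
      (∀ u ∈ Metric.ball (0 : Z) R, Φ T u = U T (Gε (GN u))) ∧
      IsSymplecticDiffeo J Gε ∧ IsSymplecticDiffeo J GN ∧
      (∀ u ∈ GN '' Metric.ball (0 : Z) R, ‖Gε u - u‖ ≤ ε) ∧
      (∀ uN uC : Z, proj b N uN = uN → proj b N uC = 0 → GN (uN + uC) = GN uN + uC) := by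
  have hJ2 := J_sq hb hJ
  have hJs := J_skew hb hJ
  have hJn := J_norm hJ2 hJs
  obtain ⟨hgc, hgi, hgs⟩ := grad_facts hh
  -- the vector field
  set X : Z → Z := fun z => J (A z) + J (gradient h z) with hXdef
  have hJA : ∀ z, HasFDerivAt (fun z => J (A z)) (J.comp A) z := fun z => (J.comp A).hasFDerivAt
  have hgd : ∀ z, HasFDerivAt (gradient h) (fderiv ℝ (gradient h) z) z := fun z =>
    (hgc.differentiable one_ne_zero z).hasFDerivAt
  have hXd : ∀ z u, fderiv ℝ X z u = J (A u) + J (fderiv ℝ (gradient h) z u) := by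
    intro z u
    have : HasFDerivAt X (J.comp A + J.comp (fderiv ℝ (gradient h) z)) z :=
      (hJA z).add (J.hasFDerivAt.comp z (hgd z))
    rw [this.fderiv]; simp
  have hX : ContDiff ℝ 1 X := (J.contDiff.comp A.contDiff).add (J.contDiff.comp hgc)
  have hH : ∀ z u v, ⟪J (fderiv ℝ X z u), v⟫ + ⟪J u, fderiv ℝ X z v⟫ = 0 := by
    intro z u v
    rw [hXd, hXd, map_add, hJ2, hJ2, hJs u, map_add, hJ2, hJ2]
    simp only [inner_add_left, inner_add_right, inner_neg_left, inner_neg_right]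
    rw [hA_selfadj, hgs]; ring
  set p : Z → ℝ := fun z => ⟪z, gradient h z⟫ - 2 * h z with hpdef
  have hh1 : ContDiff ℝ 1 h := hh.of_le (by exact_mod_cast le_top)
  have hp : ContDiff ℝ 1 p := (contDiff_id.inner ℝ hgc).sub (contDiff_const.mul hh1)
  have hpX : ∀ z u, fderiv ℝ p z u = ⟪J (X z), u⟫ + ⟪J z, fderiv ℝ X z u⟫ := by
    intro z u
    have h1 := ((hasFDerivAt_id z).inner ℝ (hgd z)).sub
      ((hh1.differentiable one_ne_zero z).hasFDerivAt.const_mul 2)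
    have h2 : fderiv ℝ p z = _ := h1.fderiv
    have h3 : J (X z) = -(A z) - gradient h z := by
      rw [hXdef]; simp only [map_add, hJ2]; abel
    rw [h2, hXd, hJs z, h3]
    simp only [map_add, hJ2]
    have h4 := hgi z u
    have h5 := hA_selfadj z u
    simp only [ContinuousLinearMap.sub_apply, ContinuousLinearMap.smul_apply, h4,
      ContinuousLinearMap.comp_apply, ContinuousLinearMap.prod_apply, fderivInnerCLM_apply,
      ContinuousLinearMap.id_apply, id, smul_eq_mul, inner_add_right, inner_neg_right,
      inner_sub_left, inner_neg_left, h5]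
    rw [real_inner_comm (gradient h z) u]
    ring
  -- Lipschitz bounds for Ψ
  have hΨL : ∀ ρ : ℝ, ∃ C : ℝ, 0 ≤ C ∧ ∀ t, |t| ≤ |T| → ∀ a c, ‖a‖ ≤ ρ → ‖c‖ ≤ ρ →
      ‖Ψ t a - Ψ t c‖ ≤ C * ‖a - c‖ := by
    intro ρ
    obtain ⟨C, hC⟩ := hH3 (|ρ| + 1) (|T| + 1) (by positivity) (by positivity)
    refine ⟨|C|, abs_nonneg _, fun t ht a c ha hc => ?_⟩
    have hρ := le_abs_self ρ
    refine (hC t (by linarith) a (by rw [mem_closedBall_zero_iff]; linarith) c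
      (by rw [mem_closedBall_zero_iff]; linarith)).trans ?_
    exact mul_le_mul_of_nonneg_right (le_abs_self C) (norm_nonneg _)
  have hΦL : ∀ ρ : ℝ, ∃ C : ℝ, 0 ≤ C ∧ ∀ t, |t| ≤ |T| → ∀ a c, ‖a‖ ≤ ρ → ‖c‖ ≤ ρ →
      ‖Φ t a - Φ t c‖ ≤ C * ‖a - c‖ := by
    intro ρ
    obtain ⟨C, hC0, hC⟩ := hΨL ρ
    refine ⟨1 + ‖ι‖ * C, by positivity, fun t ht a c ha hc => ?_⟩
    have e1 : (a + ι (Ψ t a)) - (c + ι (Ψ t c)) = (a - c) + ι (Ψ t a - Ψ t c) := by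
      rw [map_sub]; abel
    rw [hΨ, hΨ, ← map_sub, hU_iso, e1]
    have h1 := norm_add_le (a - c) (ι (Ψ t a - Ψ t c))
    have h2 := ι.le_opNorm (Ψ t a - Ψ t c)
    have h3 := mul_le_mul_of_nonneg_left (hC t ht a c ha hc) (norm_nonneg ι)
    linarith
  have hL : ∀ a : Z, ∃ C : ℝ, 0 ≤ C ∧ ∀ τ, |τ| ≤ |T| → ∀ c, ‖c - a‖ ≤ 1 →
      ‖Φ τ c - Φ τ a‖ ≤ C * ‖c - a‖ := by
    intro a
    obtain ⟨C, hC0, hC⟩ := hΦL (‖a‖ + 1)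
    refine ⟨C, hC0, fun τ hτ c hc => hC τ hτ c a ?_ (by linarith)⟩
    have := norm_add_le (c - a) a
    rw [sub_add_cancel] at this
    linarith
  have hΦs := flow_symplectic J hJn hX Φ hΦ_zero hΦ_ode hΦ_C1 hH T hL
  have hΦa := flow_action J hX Φ hΦ_zero hΦ_ode hΦ_C1 hp hpX T hL
  -- the linear group
  have hUs : ∀ t ξ η, ⟪J (U t ξ), U t η⟫ = ⟪J ξ, η⟫ := by
    intro t ξ η
    have hder : ∀ τ, HasDerivAt (fun τ => ⟪J (U τ ξ), U τ η⟫) ((fun _ : ℝ => (0 : ℝ)) τ) τ := by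
      intro τ
      have h1 := HasDerivAt.inner ℝ (J.hasFDerivAt.comp_hasDerivAt τ (hU_ode ξ τ)) (hU_ode η τ)
      have h2 : ⟪J (U τ ξ), J (A (U τ η))⟫ + ⟪J (J (A (U τ ξ))), U τ η⟫ = 0 := by
        rw [hJ2, hJs, hJ2, inner_neg_left, inner_neg_right, hA_selfadj]; ring
      exact h2 ▸ h1
    have := growth hder t 0 (by simp)
    rw [zero_mul] at this
    have h0 := sub_eq_zero.1 (norm_le_zero_iff.1 this)
    rw [h0, hU_zero]; simp
  have hU1 : ∀ z, U (-T) (U T z) = z := by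
    intro z
    have := hU_group (-T) T
    rw [neg_add_cancel, hU_zero] at this
    simpa using (congrArg (fun L : Z →L[ℝ] Z => L z) this).symm
  have hU2 : ∀ z, U T (U (-T) z) = z := by
    intro z
    have := hU_group T (-T)
    rw [add_neg_cancel, hU_zero] at this
    simpa using (congrArg (fun L : Z →L[ℝ] Z => L z) this).symm
  have hΦ1 : ∀ z, Φ (-T) (Φ T z) = z := by
    intro z; rw [← hΦ_group, neg_add_cancel, hΦ_zero]
  have hΦ2 : ∀ z, Φ T (Φ (-T) z) = z := by
    intro z; rw [← hΦ_group, add_neg_cancel, hΦ_zero]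
  -- the map `V0`
  set V0 : Z → Z := fun x => U (-T) (Φ T x) with hV0def
  set W0 : Z → Z := fun z => Φ (-T) (U T z) with hW0def
  have hV0C : ContDiff ℝ 1 V0 := (U (-T)).contDiff.comp (hΦ_C1 T)
  have hW0C : ContDiff ℝ 1 W0 := (hΦ_C1 (-T)).comp (U T).contDiff
  have hWV0 : ∀ x, W0 (V0 x) = x := fun x => by simp only [hV0def, hW0def, hU2, hΦ1]
  have hVW0 : ∀ x, V0 (W0 x) = x := fun x => by simp only [hV0def, hW0def, hΦ2, hU1]
  have hV0e : ∀ x, V0 x = x + ι (Ψ T x) := fun x => by simp only [hV0def, hΨ T, hU1]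
  have hW0e : ∀ x, W0 x = x + ((U (-T)).comp ι) (Ψ (-T) (U T x)) := fun x => by
    simp only [hW0def, hΨ (-T), map_add, hU1, ContinuousLinearMap.comp_apply]
  have hV0d : ∀ x ξ, fderiv ℝ V0 x ξ = U (-T) (fderiv ℝ (Φ T) x ξ) := by
    intro x ξ
    have : HasFDerivAt V0 ((U (-T)).comp (fderiv ℝ (Φ T) x)) x :=
      (U (-T)).hasFDerivAt.comp x ((hΦ_C1 T).differentiable one_ne_zero x).hasFDerivAt
    rw [this.fderiv]; rfl
  have hV0s : ∀ z ξ η, ⟪J (fderiv ℝ V0 z ξ), fderiv ℝ V0 z η⟫ = ⟪J ξ, η⟫ := by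
    intro z ξ η
    rw [hV0d, hV0d, hUs, hΦs]
  have hSD0 : SD J V0 := ⟨W0, hWV0, hVW0, hV0C, hW0C, hV0s⟩
  set v0 : Z := V0 0 with hv0
  set V : Z → Z := fun x => V0 x - v0 with hVdef
  set W : Z → Z := fun z => W0 (z + v0) with hWdef
  have hVd : ∀ x, fderiv ℝ V x = fderiv ℝ V0 x := fun x => by
    rw [hVdef]; exact fderiv_sub_const _
  set s : Z → ℝ := fun x => (∫ τ in (0:ℝ)..T, p (Φ τ x)) - ⟪J v0, V0 x⟫ with hsdef
  have hsd : ∀ x, HasFDerivAt s (((innerSL ℝ (J (Φ T x))).comp (fderiv ℝ (Φ T) x)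
      - innerSL ℝ (J x)) - (innerSL ℝ (J v0)).comp (fderiv ℝ V0 x)) x := fun x =>
    (hΦa x).sub ((innerSL ℝ (J v0)).hasFDerivAt.comp x
      (hV0C.differentiable one_ne_zero x).hasFDerivAt)
  have hs : ∀ x ξ, fderiv ℝ s x ξ = ⟪J (V x), fderiv ℝ V x ξ⟫ - ⟪J x, ξ⟫ := by
    intro x ξ
    rw [(hsd x).fderiv, hVd]
    have h1 : ⟪J (V0 x), fderiv ℝ V0 x ξ⟫ = ⟪J (Φ T x), fderiv ℝ (Φ T) x ξ⟫ := by
      rw [hV0d]; exact hUs _ _ _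
    have h2 : ⟪J (V x), fderiv ℝ V0 x ξ⟫
        = ⟪J (V0 x), fderiv ℝ V0 x ξ⟫ - ⟪J v0, fderiv ℝ V0 x ξ⟫ := by
      rw [hVdef]; simp only [map_sub, inner_sub_left]
    rw [h2, h1]
    simp only [ContinuousLinearMap.sub_apply, ContinuousLinearMap.comp_apply, innerSL_apply_apply]
    ring
  have hTT : |-T| ≤ |T| := by rw [abs_neg]
  have hWn : ∀ (ρ : ℝ) (a : Z), ‖a‖ ≤ ρ → ‖U T (a + v0)‖ ≤ ρ + ‖v0‖ := fun ρ a ha => by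
    rw [hU_iso]; exact (norm_add_le _ _).trans (by linarith)
  have hWdi : ∀ a c : Z, ‖U T (a + v0) - U T (c + v0)‖ = ‖a - c‖ := fun a c => by
    rw [← map_sub, hU_iso, add_sub_add_right_eq_sub]
  obtain ⟨N0, hN0⟩ := core J hJ2 hJs hJn (V := V) (W := W) (hV0C.sub contDiff_const)
    (hW0C.comp (contDiff_id.add contDiff_const))
    (fun x => by simp only [hVdef, hWdef, hVW0, add_sub_cancel_right])
    (fun x => by simp only [hVdef, hWdef, hWV0, sub_add_cancel])
    (by simp [hVdef, hv0])
    (fun z ξ η => by rw [hVd]; exact hV0s z ξ η)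
    (PC b) (PC_idem hb.1) (PC_symm b) (PC_J hJ hJs) (PC_norm hb.1) (PC_fin b)
    (by
      intro ρ
      obtain ⟨C, hC0, hC⟩ := hΦL ρ
      refine ⟨C, hC0, fun a c ha hc => ?_⟩
      have e1 : V a - V c = U (-T) (Φ T a - Φ T c) := by
        simp only [hVdef, hV0def, map_sub]; abel
      rw [e1, hU_iso]
      exact hC T le_rfl a c ha hc)
    (by
      intro ρ
      obtain ⟨C, hC0, hC⟩ := hΦL (ρ + ‖v0‖)
      refine ⟨C, hC0, fun a c ha hc => ?_⟩
      have := hC (-T) hTT _ _ (hWn ρ a ha) (hWn ρ c hc)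
      rw [hWdi] at this
      exact this)
    (by
      intro ρ δ hδ
      obtain ⟨C, hC0, hC⟩ := hΨL ρ
      obtain ⟨N0, hN0⟩ := compact_tail hb ι hι_cmp (δ / (C + 1)) (by positivity)
      refine ⟨N0, fun N hN a c ha hc => ?_⟩
      have e1 : (V a - a) - (V c - c) = ι (Ψ T a - Ψ T c) := by
        simp only [hVdef, hV0e, map_sub]; abel
      rw [e1]
      refine (hN0 N hN _).trans ?_
      have h1 := hC T le_rfl a c ha hc
      have h2 : ‖Ψ T a - Ψ T c‖ ≤ (C + 1) * ‖a - c‖ := by nlinarith [norm_nonneg (a - c)]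
      calc δ / (C + 1) * ‖Ψ T a - Ψ T c‖ ≤ δ / (C + 1) * ((C + 1) * ‖a - c‖) := by gcongr
        _ = δ * ‖a - c‖ := by field_simp)
    (by
      intro ρ δ hδ
      obtain ⟨C, hC0, hC⟩ := hΨL (ρ + ‖v0‖)
      obtain ⟨N0, hN0⟩ := compact_tail hb ((U (-T)).comp ι) (hι_cmp.clm_comp (U (-T)))
        (δ / (C + 1)) (by positivity)
      refine ⟨N0, fun N hN a c ha hc => ?_⟩
      have e1 : (W a - a) - (W c - c)
          = ((U (-T)).comp ι) (Ψ (-T) (U T (a + v0)) - Ψ (-T) (U T (c + v0))) := by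
        simp only [hWdef, hW0e, map_sub]; abel
      rw [e1]
      refine (hN0 N hN _).trans ?_
      have h1 := hC (-T) hTT _ _ (hWn ρ a ha) (hWn ρ c hc)
      rw [hWdi] at h1
      have h2 : ‖Ψ (-T) (U T (a + v0)) - Ψ (-T) (U T (c + v0))‖ ≤ (C + 1) * ‖a - c‖ := by
        nlinarith [norm_nonneg (a - c)]
      calc δ / (C + 1) * ‖Ψ (-T) (U T (a + v0)) - Ψ (-T) (U T (c + v0))‖
          ≤ δ / (C + 1) * ((C + 1) * ‖a - c‖) := by gcongr
        _ = δ * ‖a - c‖ := by field_simp)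
    s (fun x => (hsd x).differentiableAt) hs (ε / 2) R (by positivity) hR
  have hev := Metric.tendsto_nhds.1 (PC_tendsto hb v0) (ε / 2) (by positivity)
  obtain ⟨N1, hN1⟩ := Filter.eventually_atTop.1 hev
  obtain ⟨G, hG, hQ, hGe⟩ := hN0 (max N0 N1) (le_max_left _ _)
  have hv := hN1 (max N0 N1) (le_max_right _ _)
  rw [dist_comm, dist_eq_norm] at hv
  set N := max N0 N1
  have hGN := hG.add_const (PC b N v0)
  obtain ⟨Gi, hGi, hGi1, hGi2⟩ := hGN.symm
  have hGi1' : ∀ u, Gi (G u + PC b N v0) = u := hGi1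
  refine ⟨N, fun x => G x + PC b N v0, fun x => V0 (Gi x), ?_, (hSD0.comp hGi).isSymplecticDiffeo,
    hGN.isSymplecticDiffeo, ?_, ?_⟩
  · intro u _
    simp only [hGi1']
    simp only [hV0def, hU2]
  · rintro _ ⟨u, hu, rfl⟩
    simp only [hGi1']
    have h1 := hGe u (le_of_lt (mem_ball_zero_iff.1 hu))
    have e1 : V0 u - (G u + PC b N v0) = (V u - G u) + (v0 - PC b N v0) := by
      simp only [hVdef]; abel
    rw [e1]
    have h2 := norm_add_le (V u - G u) (v0 - PC b N v0)
    linarith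
  · intro uN uC _ hC
    rw [PC_proj] at hC
    simp only [hQ.1 uN uC hC]
    abel

end Kuksin
end
end

section
/- Let n ∈ ℕ and let F : Z → Z be a map of the form F(z^n + z_n) = F^n(z^n) + z_n for z^n ∈ Z^n and z_n ∈ Z_n, where F^n is a symplectic diffeomorphism of Z^n. Then for every open set O ⊂ Z, c(F(O)) = c(O), where c is Kuksin's symplectic capacity on Z. -/
open scoped RealInnerProductSpace BigOperators ENNReal NNReal
open Metric

noncomputable section

namespace Kuksin

variable {Z : Type*} [NormedAddCommGroup Z] [InnerProductSpace ℝ Z] [CompleteSpace Z]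

def P (b : ℕ × Bool → Z) (n : ℕ) : Z →L[ℝ] Z :=
  ∑ j ∈ Finset.range n, ((innerSL ℝ (b (j, true))).smulRight (b (j, true)) +
    (innerSL ℝ (b (j, false))).smulRight (b (j, false)))

theorem P_apply (b : ℕ × Bool → Z) (n : ℕ) (z : Z) : P b n z = proj b n z := by
  simp [P, proj]

theorem P_basis (b : ℕ × Bool → Z) (hb : IsHilbertBasis b) (n : ℕ) (i : ℕ × Bool) :
    P b n (b i) = if i.1 < n then b i else 0 := by
  have h := orthonormal_iff_ite.1 hb.1
  rw [P_apply, proj]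
  obtain ⟨k, s⟩ := i
  have : ∀ j ∈ Finset.range n, (⟪b (j, true), b (k, s)⟫ • b (j, true)
      + ⟪b (j, false), b (k, s)⟫ • b (j, false)) = if j = k then b (k, s) else 0 := by
    intro j _
    rw [h, h]
    by_cases hjk : j = k
    · subst hjk; cases s <;> simp
    · simp [hjk]
  rw [Finset.sum_congr rfl this]
  simp

theorem clm_ext (b : ℕ × Bool → Z) (hb : IsHilbertBasis b) (A B : Z →L[ℝ] Z)
    (h : ∀ i, A (b i) = B (b i)) : A = B := by
  apply ContinuousLinearMap.ext_on (s := Set.range b)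
  · exact Submodule.dense_iff_topologicalClosure_eq_top.2 hb.2
  · rintro _ ⟨i, rfl⟩; exact h i

theorem PP (b : ℕ × Bool → Z) (hb : IsHilbertBasis b) {n N : ℕ} (h : n ≤ N) (z : Z) :
    P b N (P b n z) = P b n z := by
  have : (P b N).comp (P b n) = P b n := by
    apply clm_ext b hb
    intro i
    by_cases hi : i.1 < n
    · simp [P_basis b hb, hi, lt_of_lt_of_le hi h]
    · simp [P_basis b hb, hi]
  exact congrArg (fun A : Z →L[ℝ] Z => A z) this

theorem PP2 (b : ℕ × Bool → Z) (hb : IsHilbertBasis b) {n N : ℕ} (h : n ≤ N) (z : Z) :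
    P b n (P b N z) = P b n z := by
  have : (P b n).comp (P b N) = P b n := by
    apply clm_ext b hb
    intro i
    by_cases hi : i.1 < N
    · simp [P_basis b hb, hi]
    · have : ¬ i.1 < n := by omega
      simp [P_basis b hb, hi, this]
  exact congrArg (fun A : Z →L[ℝ] Z => A z) this

theorem JP (b : ℕ × Bool → Z) (hb : IsHilbertBasis b) (J : Z →L[ℝ] Z) (hJ : IsJ b J)
    (n : ℕ) (z : Z) : P b n (J z) = J (P b n z) := by
  have : (P b n).comp J = J.comp (P b n) := by
    apply clm_ext b hb
    rintro ⟨j, s⟩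
    by_cases hi : j < n <;> cases s <;> simp [P_basis b hb, hi, (hJ j).1, (hJ j).2]
  exact congrArg (fun A : Z →L[ℝ] Z => A z) this

theorem JJ (b : ℕ × Bool → Z) (hb : IsHilbertBasis b) (J : Z →L[ℝ] Z) (hJ : IsJ b J)
    (z : Z) : J (J z) = - z := by
  have : J.comp J = - ContinuousLinearMap.id ℝ Z := by
    apply clm_ext b hb
    rintro ⟨j, s⟩
    cases s <;> simp [(hJ j).1, (hJ j).2]
  exact congrArg (fun A : Z →L[ℝ] Z => A z) this

theorem P_symm (b : ℕ × Bool → Z) (n : ℕ) (x y : Z) : ⟪P b n x, y⟫ = ⟪x, P b n y⟫ := by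
  simp only [P_apply, proj, sum_inner, inner_sum, inner_add_left, inner_add_right,
    real_inner_smul_left, real_inner_smul_right]
  apply Finset.sum_congr rfl
  intro j _
  rw [real_inner_comm (b (j, true)) x, real_inner_comm (b (j, false)) x]
  ring

theorem compact_ball (b : ℕ × Bool → Z) (n : ℕ) (R : ℝ) :
    ∃ K : Set Z, IsCompact K ∧ (∀ z ∈ closedBall (0 : Z) R, P b n z ∈ K) := by
  let S : Submodule ℝ Z := Submodule.span ℝ (b '' (Finset.range n ×ˢ Finset.univ : Finset (ℕ × Bool)))
  have hfd : FiniteDimensional ℝ S :=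
    FiniteDimensional.span_of_finite ℝ ((Finset.finite_toSet _).image b)
  have hmem : ∀ z, P b n z ∈ S := by
    intro z
    rw [P_apply, proj]
    refine Submodule.sum_mem _ fun j hj => Submodule.add_mem _ ?_ ?_ <;>
    · apply Submodule.smul_mem
      apply Submodule.subset_span
      refine ⟨_, ?_, rfl⟩
      simpa using hj
  refine ⟨S.subtype '' closedBall 0 (‖P b n‖ * R), ?_, ?_⟩
  · exact (isCompact_closedBall _ _).image S.subtypeL.continuous
  · intro z hz
    refine ⟨⟨P b n z, hmem z⟩, ?_, rfl⟩
    rw [mem_closedBall_zero_iff] at *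
    exact ((P b n).le_opNorm z).trans (by gcongr)

/-- extension of a map of `Z^n` -/
def ext' (b : ℕ × Bool → Z) (n : ℕ) (Fn : Z → Z) (z : Z) : Z :=
  Fn (P b n z) + (z - P b n z)

theorem ext_uc (b : ℕ × Bool → Z) (n : ℕ) (Fn : Z → Z) (hc : Continuous Fn) (R : ℝ) :
    UniformContinuousOn (ext' b n Fn) (closedBall 0 R) := by
  obtain ⟨K, hK, hKm⟩ := compact_ball b n R
  have h1 : UniformContinuousOn Fn K :=
    hK.uniformContinuousOn_of_continuous hc.continuousOn
  have h2 : UniformContinuousOn (Fn ∘ P b n) (closedBall 0 R) :=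
    h1.comp (P b n).uniformContinuous.uniformContinuousOn hKm
  have h3 : UniformContinuousOn (fun z => z - P b n z) (closedBall 0 R) :=
    (uniformContinuous_id.sub (P b n).uniformContinuous).uniformContinuousOn
  rw [uniformContinuousOn_iff_restrict] at h2 h3 ⊢
  exact h2.add h3

theorem ext_bdd (b : ℕ × Bool → Z) (n : ℕ) (Fn : Z → Z) (hc : Continuous Fn) (S : Set Z)
    (hS : Bornology.IsBounded S) : Bornology.IsBounded (ext' b n Fn '' S) := by
  obtain ⟨R, hR⟩ := hS.subset_closedBall 0
  obtain ⟨K, hK, hKm⟩ := compact_ball b n R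
  obtain ⟨C, hC⟩ := (hK.image hc).isBounded.exists_norm_le
  refine isBounded_iff_forall_norm_le.2 ⟨C + (R + ‖P b n‖ * R), ?_⟩
  rintro _ ⟨z, hz, rfl⟩
  have hz' := hR hz
  have h1 := hC _ ⟨_, hKm z hz', rfl⟩
  rw [mem_closedBall_zero_iff] at hz'
  have h2 : ‖P b n z‖ ≤ ‖P b n‖ * R := ((P b n).le_opNorm z).trans (by gcongr)
  exact (norm_add_le _ _).trans (add_le_add h1 ((norm_sub_le _ _).trans (add_le_add hz' h2)))

theorem core_s6 (b : ℕ × Bool → Z) (J : Z →L[ℝ] Z) (hb : IsHilbertBasis b) (hJ : IsJ b J)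
    (n : ℕ) (F G : Z → Z) (hFs : ContDiff ℝ (⊤ : ℕ∞) F) (hGs : ContDiff ℝ (⊤ : ℕ∞) G)
    (hGF : ∀ z, G (F z) = z) (hFG : ∀ z, F (G z) = z)
    (hFP : ∀ N ≥ n, ∀ z, P b N (F z) = F (P b N z))
    (hsymp : ∀ z ξ η, ⟪J (fderiv ℝ F z ξ), fderiv ℝ F z η⟫ = ⟪J ξ, η⟫)
    (hFuc : ∀ R, UniformContinuousOn F (closedBall 0 R))
    (hGb : ∀ S, Bornology.IsBounded S → Bornology.IsBounded (G '' S))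
    (O : Set Z) (hO : IsOpen O) : capSet b J O ⊆ capSet b J (F '' O) := by
  rintro m' ⟨hm', H⟩
  refine ⟨hm', fun m f hmm hf => ?_⟩
  obtain ⟨h0, hs, hr, ⟨U, hU, ⟨u, hu⟩, hUO, hUf⟩, hfr, hbd, ⟨d, hd, hdist⟩⟩ := hf
  let e : Z ≃ₜ Z :=
    { toFun := F, invFun := G, left_inv := hGF, right_inv := hFG
      continuous_toFun := hFs.continuous, continuous_invFun := hGs.continuous }
  have hopen : IsOpen (F '' O) := e.isOpenMap O hO
  have hfront : ∀ y ∈ frontier O, F y ∈ frontier (F '' O) := by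
    intro y hy
    have : e '' frontier O = frontier (e '' O) := e.image_frontier O
    have h2 : F y ∈ e '' frontier O := ⟨y, hy, rfl⟩
    rw [this] at h2; exact h2
  have hFd : ∀ z, HasFDerivAt F (fderiv ℝ F z) z := fun z =>
    (hFs.differentiable (by simp) z).hasFDerivAt
  have hGd : ∀ z, HasFDerivAt G (fderiv ℝ G z) z := fun z =>
    (hGs.differentiable (by simp) z).hasFDerivAt
  have hadm : IsAdmissible O m (f ∘ F) := by
    have hbd' : Bornology.IsBounded {z ∈ O | (f ∘ F) z < m} := by
      apply (hGb _ hbd).subset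
      rintro z ⟨hz, hzm⟩
      exact ⟨F z, ⟨⟨z, hz, rfl⟩, hzm⟩, hGF z⟩
    refine ⟨h0, hs.comp hFs.contDiffOn (fun z hz => ⟨z, hz, rfl⟩),
      fun z hz => hr _ ⟨z, hz, rfl⟩, ⟨F ⁻¹' U, hU.preimage hFs.continuous, ⟨G u, ?_⟩, ?_, ?_⟩,
      fun z hz => hfr _ (hfront z hz), hbd', ?_⟩
    · simpa [hFG] using hu
    · intro z hz
      obtain ⟨y, hy, hyz⟩ := hUO hz
      have : y = z := by rw [← hGF y, hyz, hGF]
      exact this ▸ hy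
    · intro z hz; exact hUf _ hz
    · obtain ⟨R, hR⟩ := hbd'.exists_norm_le
      obtain ⟨δ, hδ, hδ'⟩ := Metric.uniformContinuousOn_iff.1 (hFuc (R + 1)) d hd
      refine ⟨min δ 1, by positivity, ?_⟩
      intro x hx y hy
      by_contra hlt
      push Not at hlt
      have hxR := hR x hx
      have hy1 : ‖y‖ ≤ R + 1 := by
        have h1 : ‖y‖ - ‖x‖ ≤ dist x y := by
          rw [dist_comm, dist_eq_norm]; exact norm_sub_norm_le _ _
        have := hlt.le.trans (min_le_right _ _)
        linarith
      have h2 := hδ' x (by rw [mem_closedBall_zero_iff]; linarith) y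
        (by rwa [mem_closedBall_zero_iff]) (hlt.trans_le (min_le_left _ _))
      have h3 := hdist (F x) ⟨⟨x, hx.1, rfl⟩, hx.2⟩ (F y) (hfront y hy)
      linarith
  obtain ⟨n₀, hn₀⟩ := H m _ hmm hadm
  refine ⟨max n₀ n, fun N hN => ?_⟩
  have hNn : n ≤ N := (le_max_right _ _).trans hN
  obtain ⟨z, ⟨hzO, hzP, hzd⟩, ⟨t₁, t₂, ht⟩, T, hT0, hT1, hT⟩ :=
    hn₀ N ((le_max_left _ _).trans hN)
  simp only [← P_apply] at hzP hzd
  refine ⟨F ∘ z, ⟨fun t => ⟨z t, hzO t, rfl⟩, fun t => ?_, fun t => ?_⟩, ⟨t₁, t₂, fun h => ht ?_⟩,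
    T, hT0, hT1, fun t => ?_⟩
  · simp only [Function.comp]
    rw [← P_apply, hFP N hNn, hzP]
  · rw [← P_apply]
    have hcomp := (hFd (z t)).comp_hasDerivAt t (hzd t)
    convert hcomp using 1
    have hfd : DifferentiableAt ℝ f (F (z t)) :=
      (hs.contDiffAt (hopen.mem_nhds ⟨z t, hzO t, rfl⟩)).differentiableAt (by simp)
    have hgrad : ∀ ξ, ⟪gradient (f ∘ F) (z t), ξ⟫ = ⟪gradient f (F (z t)), fderiv ℝ F (z t) ξ⟫ := by
      intro ξ
      have h1 := hfd.hasFDerivAt.comp (z t) (hFd (z t))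
      simp only [gradient, InnerProductSpace.toDual_symm_apply]
      rw [h1.fderiv]; rfl
    have hcomm : ∀ ξ, P b N (fderiv ℝ F (z t) ξ) = fderiv ℝ F (z t) (P b N ξ) := by
      intro ξ
      have h1 := (P b N).hasFDerivAt.comp (z t) (hFd (z t))
      have h2 := (hFd (P b N (z t))).comp (z t) (P b N).hasFDerivAt
      have h3 : (P b N ∘ F) = F ∘ P b N := funext (hFP N hNn)
      rw [h3] at h1
      have h4 := h1.unique h2
      rw [hzP] at h4
      exact congrArg (fun A : Z →L[ℝ] Z => A ξ) h4
    have hsurj : ∀ v, ∃ ξ, fderiv ℝ F (z t) ξ = v := by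
      intro v
      have h1 := (hFd (G (F (z t)))).comp (F (z t)) (hGd (F (z t)))
      have h3 : F ∘ G = id := funext hFG
      rw [h3, hGF] at h1
      exact ⟨_, congrArg (fun A : Z →L[ℝ] Z => A v) (h1.unique (hasFDerivAt_id _))⟩
    have key : J (fderiv ℝ F (z t) (J (P b N (gradient (f ∘ F) (z t))))) =
        - P b N (gradient f (F (z t))) := by
      apply ext_inner_right ℝ
      intro v
      obtain ⟨ξ, rfl⟩ := hsurj v
      rw [hsymp, JJ b hb J hJ, inner_neg_left, inner_neg_left, P_symm, hgrad, P_symm, hcomm]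
    have := congrArg J key
    rw [JJ b hb J hJ, map_neg] at this
    exact (neg_injective this).symm
  · rw [← hGF (z t₁), ← hGF (z t₂)]; exact congrArg G h
  · simp [Function.comp, hT]

theorem ext_fderiv (b : ℕ × Bool → Z) (n : ℕ) (Fn : Z → Z) (hFs : ContDiff ℝ (⊤ : ℕ∞) Fn)
    (z ξ : Z) : fderiv ℝ (ext' b n Fn) z ξ =
      fderiv ℝ Fn (P b n z) (P b n ξ) + (ξ - P b n ξ) := by
  have h1 : HasFDerivAt Fn (fderiv ℝ Fn (P b n z)) (P b n z) :=
    (hFs.differentiable (by simp) _).hasFDerivAt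
  have h2 := (h1.comp z (P b n).hasFDerivAt).add
    ((hasFDerivAt_id z).sub (P b n).hasFDerivAt)
  have h3 : HasFDerivAt (ext' b n Fn) _ z := h2
  rw [h3.fderiv]; simp

theorem fderiv_maps (b : ℕ × Bool → Z) (hb : IsHilbertBasis b) (n : ℕ) (Fn : Z → Z)
    (hFs : ContDiff ℝ (⊤ : ℕ∞) Fn)
    (hm : ∀ z : Z, P b n z = z → P b n (Fn z) = Fn z) (z ξ : Z) :
    P b n (fderiv ℝ Fn (P b n z) (P b n ξ)) = fderiv ℝ Fn (P b n z) (P b n ξ) := by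
  have h1 : HasFDerivAt Fn (fderiv ℝ Fn (P b n z)) (P b n z) :=
    (hFs.differentiable (by simp) _).hasFDerivAt
  have h2 := h1.comp z (P b n).hasFDerivAt
  have h3 := (P b n).hasFDerivAt.comp z h2
  have h4 : P b n ∘ (Fn ∘ P b n) = Fn ∘ P b n :=
    funext fun x => hm _ (PP b hb le_rfl x)
  rw [h4] at h3
  exact congrArg (fun A : Z →L[ℝ] Z => A ξ) (h3.unique h2)

theorem inner_split (b : ℕ × Bool → Z) (hb : IsHilbertBasis b) (J : Z →L[ℝ] Z) (hJ : IsJ b J)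
    (n : ℕ) (a a' ξ η : Z) (ha : P b n a = a) (ha' : P b n a' = a') :
    ⟪J (a + (ξ - P b n ξ)), a' + (η - P b n η)⟫ =
      ⟪J a, a'⟫ + ⟪J (ξ - P b n ξ), η - P b n η⟫ := by
  have h0 : ∀ x, P b n (x - P b n x) = 0 := fun x => by
    rw [map_sub, PP b hb le_rfl, sub_self]
  have h1 : ⟪J a, η - P b n η⟫ = 0 := by
    rw [← ha, ← JP b hb J hJ, P_symm, h0, inner_zero_right]
  have h2 : ⟪J (ξ - P b n ξ), a'⟫ = 0 := by
    rw [← ha', ← P_symm, JP b hb J hJ, h0, map_zero, inner_zero_left]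
  rw [map_add, inner_add_left, inner_add_right, inner_add_right, h1, h2]
  ring

theorem step_s6 (b : ℕ × Bool → Z) (J : Z →L[ℝ] Z) (hb : IsHilbertBasis b) (hJ : IsJ b J)
    (n : ℕ) (Fn Fninv : Z → Z)
    (hFn_maps : ∀ z : Z, P b n z = z → P b n (Fn z) = Fn z)
    (hFninv_maps : ∀ z : Z, P b n z = z → P b n (Fninv z) = Fninv z)
    (hleft : ∀ z : Z, P b n z = z → Fninv (Fn z) = z)
    (hright : ∀ z : Z, P b n z = z → Fn (Fninv z) = z)
    (hFs : ContDiff ℝ (⊤ : ℕ∞) Fn) (hGs : ContDiff ℝ (⊤ : ℕ∞) Fninv)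
    (hsymp : ∀ z : Z, P b n z = z → ∀ ξ η : Z, P b n ξ = ξ → P b n η = η →
      ⟪J (fderiv ℝ Fn z ξ), fderiv ℝ Fn z η⟫ = ⟪J ξ, η⟫)
    (O : Set Z) (hO : IsOpen O) : capSet b J O ⊆ capSet b J (ext' b n Fn '' O) := by
  have hid : ∀ x, P b n (P b n x) = P b n x := PP b hb le_rfl
  have hcancel : ∀ A B : Z → Z, (∀ z : Z, P b n z = z → P b n (A z) = A z) →
      (∀ z : Z, P b n z = z → B (A z) = z) → ∀ z, ext' b n B (ext' b n A z) = z := by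
    intro A B hA hBA z
    have h1 : P b n (ext' b n A z) = A (P b n z) := by
      simp [ext', hid, hA _ (hid z)]
    rw [ext', h1, hBA _ (hid z), ext']
    abel
  have hsm : ∀ A : Z → Z, ContDiff ℝ (⊤ : ℕ∞) A → ContDiff ℝ (⊤ : ℕ∞) (ext' b n A) := by
    intro A hA
    exact (hA.comp (P b n).contDiff).add (contDiff_id.sub (P b n).contDiff)
  refine core_s6 b J hb hJ n (ext' b n Fn) (ext' b n Fninv) (hsm _ hFs) (hsm _ hGs)
    (hcancel _ _ hFn_maps hleft) (hcancel _ _ hFninv_maps hright) ?_ ?_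
    (ext_uc b n Fn hFs.continuous) (ext_bdd b n Fninv hGs.continuous) O hO
  · intro N hN z
    have h1 : P b N (Fn (P b n z)) = Fn (P b n z) := by
      rw [← hFn_maps _ (hid z), PP b hb hN]
    simp [ext', h1, PP2 b hb hN, PP b hb hN]
  · intro z ξ η
    rw [ext_fderiv b n Fn hFs, ext_fderiv b n Fn hFs,
      inner_split b hb J hJ n _ _ _ _ (fderiv_maps b hb n Fn hFs hFn_maps z ξ)
        (fderiv_maps b hb n Fn hFs hFn_maps z η), hsymp _ (hid z) _ _ (hid ξ) (hid η),
      ← inner_split b hb J hJ n _ _ _ _ (hid ξ) (hid η)]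
    simp

/-- If `F : Z → Z` has the form `F(zⁿ + z_n) = Fⁿ(zⁿ) + z_n` with `Fⁿ` a
symplectic diffeomorphism of `Zⁿ`, then `c(F(O)) = c(O)` for every open `O ⊆ Z`.
Here `Fⁿ` (given together with its inverse `Fninv`) maps `Zⁿ = {z | Πⁿ z = z}` bijectively
onto itself, is smooth with smooth inverse, and its differential preserves the symplectic
form `ω(ξ, η) = ⟪Jξ, η⟫` on `Zⁿ`. -/
theorem cap_image_finiteDim_symplectomorphism
    {Z : Type*} [NormedAddCommGroup Z] [InnerProductSpace ℝ Z] [CompleteSpace Z]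
    (b : ℕ × Bool → Z) (J : Z →L[ℝ] Z) (hb : IsHilbertBasis b) (hJ : IsJ b J)
    (n : ℕ) (F Fn Fninv : Z → Z)
    (hFn_maps : ∀ z : Z, proj b n z = z → proj b n (Fn z) = Fn z)
    (hFninv_maps : ∀ z : Z, proj b n z = z → proj b n (Fninv z) = Fninv z)
    (hleft : ∀ z : Z, proj b n z = z → Fninv (Fn z) = z)
    (hright : ∀ z : Z, proj b n z = z → Fn (Fninv z) = z)
    (hFn_smooth : ContDiff ℝ (⊤ : ℕ∞) Fn) (hFninv_smooth : ContDiff ℝ (⊤ : ℕ∞) Fninv)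
    (hFn_symp : ∀ z : Z, proj b n z = z → ∀ ξ η : Z, proj b n ξ = ξ → proj b n η = η →
      ⟪J (fderiv ℝ Fn z ξ), fderiv ℝ Fn z η⟫ = ⟪J ξ, η⟫)
    (hF : ∀ z : Z, F z = Fn (proj b n z) + (z - proj b n z))
    (O : Set Z) (hO : IsOpen O) :
    cap b J (F '' O) = cap b J O := by
  simp only [← P_apply] at hFn_maps hFninv_maps hleft hright hFn_symp hF
  have hFe : F = ext' b n Fn := funext hF
  have hid : ∀ x, P b n (P b n x) = P b n x := PP b hb le_rfl
  have hsymp' : ∀ z : Z, P b n z = z → ∀ ξ η : Z, P b n ξ = ξ → P b n η = η →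
      ⟪J (fderiv ℝ Fninv z ξ), fderiv ℝ Fninv z η⟫ = ⟪J ξ, η⟫ := by
    intro z hz ξ η hξ hη
    have hm := fderiv_maps b hb n Fninv hFninv_smooth hFninv_maps z
    have h1 : HasFDerivAt Fninv (fderiv ℝ Fninv (P b n z)) (P b n z) :=
      (hFninv_smooth.differentiable (by simp) _).hasFDerivAt
    have h2 : HasFDerivAt Fn (fderiv ℝ Fn (Fninv (P b n z))) (Fninv (P b n z)) :=
      (hFn_smooth.differentiable (by simp) _).hasFDerivAt
    have h3 := h2.comp z (h1.comp z (P b n).hasFDerivAt)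
    have h4 : Fn ∘ (Fninv ∘ P b n) = P b n := funext fun x => hright _ (hid x)
    rw [h4] at h3
    have h5 : ∀ v, fderiv ℝ Fn (Fninv (P b n z)) (fderiv ℝ Fninv (P b n z) (P b n v)) = P b n v :=
      fun v => congrArg (fun A : Z →L[ℝ] Z => A v) (h3.unique (P b n).hasFDerivAt)
    have h6 := hFn_symp (Fninv (P b n z)) (hFninv_maps _ (hid z)) _ _ (hm ξ) (hm η)
    rw [h5, h5] at h6
    rw [hz, hξ, hη] at h6
    exact h6.symm
  have hA := step_s6 b J hb hJ n Fn Fninv hFn_maps hFninv_maps hleft hright hFn_smooth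
    hFninv_smooth hFn_symp
  have hB := step_s6 b J hb hJ n Fninv Fn hFninv_maps hFn_maps hright hleft hFninv_smooth
    hFn_smooth hsymp'
  have hinv : ∀ z, ext' b n Fninv (ext' b n Fn z) = z := by
    intro z
    have h1 : P b n (ext' b n Fn z) = Fn (P b n z) := by
      simp [ext', hid, hFn_maps _ (hid z)]
    rw [ext', h1, hleft _ (hid z), ext']
    abel
  have hinv' : ∀ z, ext' b n Fn (ext' b n Fninv z) = z := by
    intro z
    have h1 : P b n (ext' b n Fninv z) = Fninv (P b n z) := by
      simp [ext', hid, hFninv_maps _ (hid z)]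
    rw [ext', h1, hright _ (hid z), ext']
    abel
  have hcont : Continuous (ext' b n Fninv) :=
    (hFninv_smooth.continuous.comp (P b n).continuous).add
      (continuous_id.sub (P b n).continuous)
  have himg : ext' b n Fn '' O = ext' b n Fninv ⁻¹' O :=
    congrFun (Set.image_eq_preimage_of_inverse hinv hinv') O
  have hopen : IsOpen (ext' b n Fn '' O) := himg ▸ hO.preimage hcont
  have hback : ext' b n Fninv '' (ext' b n Fn '' O) = O := by
    rw [Set.image_image]; simp [hinv]
  have hB' := hB _ hopen
  rw [hback] at hB'
  rw [hFe, cap, cap, Set.Subset.antisymm hB' (hA O hO)]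

end Kuksin
end
end

section
/- For every open set O ⊂ Z and every ξ ∈ Z, one has c(O + ξ) = c(O), where O + ξ = {z + ξ : z ∈ O} and c is Kuksin's symplectic capacity on Z. -/
open scoped RealInnerProductSpace BigOperators ENNReal NNReal
open Metric

noncomputable section

namespace Kuksin

variable {Z : Type*} [NormedAddCommGroup Z] [InnerProductSpace ℝ Z] [CompleteSpace Z]

/-- The set `O + ξ` in preimage form. -/
lemma mem_tr {Z : Type*} [NormedAddCommGroup Z] (O : Set Z) (ξ x : Z) :
    x ∈ (fun z : Z => z + ξ) '' O ↔ x - ξ ∈ O := by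
  constructor
  · rintro ⟨z, hz, rfl⟩; simpa using hz
  · intro h; exact ⟨x - ξ, h, by simp⟩

lemma mem_of_close {Z : Type*} [NormedAddCommGroup Z] [InnerProductSpace ℝ Z]
    {O A : Set Z} {d : ℝ} (hA : A ⊆ O)
    (h : ∀ x ∈ A, ∀ y ∈ frontier O, d ≤ dist x y) {x y : Z} (hx : x ∈ A)
    (hxy : dist x y < d) : y ∈ O := by
  by_contra hy
  have hp : IsPreconnected (segment ℝ x y) := (convex_segment x y).isPreconnected
  have : ((segment ℝ x y) ∩ frontier O).Nonempty := by
    by_contra hne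
    have hI : ∀ w ∈ segment ℝ x y, w ∈ interior O ∨ w ∈ (closure O)ᶜ := by
      intro w hw
      by_contra hcon
      push Not at hcon
      exact hne ⟨w, hw, not_not.1 hcon.2, hcon.1⟩
    obtain ⟨w, _, hw1, hw2⟩ := hp (interior O) (closure O)ᶜ isOpen_interior
      isClosed_closure.isOpen_compl hI
      ⟨x, left_mem_segment ℝ x y, (hI x (left_mem_segment ℝ x y)).resolve_right
        fun h => h (subset_closure (hA hx))⟩
      ⟨y, right_mem_segment ℝ x y, (hI y (right_mem_segment ℝ x y)).resolve_left
        fun h => hy (interior_subset h)⟩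
    exact hw2 (subset_closure (interior_subset hw1))
  obtain ⟨p, hp1, hp2⟩ := this
  have h1 := h x hx p hp2
  have h3 := dist_add_dist_of_mem_segment hp1
  have h4 : 0 ≤ dist p y := dist_nonneg
  linarith

lemma proj_add {Z : Type*} [NormedAddCommGroup Z] [InnerProductSpace ℝ Z]
    (b : ℕ × Bool → Z) (n : ℕ) (x y : Z) :
    proj b n (x + y) = proj b n x + proj b n y := by
  simp only [proj, ← Finset.sum_add_distrib, inner_add_right, add_smul]
  refine Finset.sum_congr rfl fun j _ => ?_
  abel

lemma proj_smul {Z : Type*} [NormedAddCommGroup Z] [InnerProductSpace ℝ Z]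
    (b : ℕ × Bool → Z) (n : ℕ) (c : ℝ) (x : Z) :
    proj b n (c • x) = c • proj b n x := by
  simp only [proj, Finset.smul_sum, inner_smul_right, smul_add, smul_smul]

lemma proj_basis {Z : Type*} [NormedAddCommGroup Z] [InnerProductSpace ℝ Z]
    (b : ℕ × Bool → Z) (hb : Orthonormal ℝ b) (n : ℕ) (i : ℕ × Bool) (hi : i.1 < n) :
    proj b n (b i) = b i := by
  obtain ⟨k, s⟩ := i
  have := orthonormal_iff_ite.1 hb
  unfold proj
  rw [Finset.sum_eq_single k]
  · cases s <;> simp [this, hb.1]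
  · intro j _ hj
    simp [this, hj]
  · intro h
    exact absurd (Finset.mem_range.2 hi) h

lemma proj_span {Z : Type*} [NormedAddCommGroup Z] [InnerProductSpace ℝ Z]
    (b : ℕ × Bool → Z) (hb : Orthonormal ℝ b) (η : Z)
    (hη : η ∈ Submodule.span ℝ (Set.range b)) :
    ∃ N : ℕ, ∀ n ≥ N, proj b n η = η := by
  induction hη using Submodule.span_induction with
  | mem x hx =>
    obtain ⟨i, rfl⟩ := hx
    exact ⟨i.1 + 1, fun n hn => proj_basis b hb n i (by omega)⟩
  | zero => exact ⟨0, fun n _ => by simp [proj]⟩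
  | add x y _ _ hx hy =>
    obtain ⟨N, hN⟩ := hx
    obtain ⟨M, hM⟩ := hy
    refine ⟨max N M, fun n hn => ?_⟩
    rw [proj_add, hN n (le_trans (le_max_left _ _) hn), hM n (le_trans (le_max_right _ _) hn)]
  | smul c x _ hx =>
    obtain ⟨N, hN⟩ := hx
    exact ⟨N, fun n hn => by rw [proj_smul, hN n hn]⟩

lemma inner_J_proj {Z : Type*} [NormedAddCommGroup Z] [InnerProductSpace ℝ Z]
    (b : ℕ × Bool → Z) (J : Z →L[ℝ] Z) (hJ : IsJ b J) (n : ℕ) (w : Z) :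
    ⟪w, J (proj b n w)⟫ = 0 := by
  unfold proj
  rw [map_sum, inner_sum]
  refine Finset.sum_eq_zero fun j _ => ?_
  rw [map_add, map_smul, map_smul, (hJ j).1, (hJ j).2, inner_add_right, inner_smul_right,
    inner_smul_right, inner_neg_right, real_inner_comm w (b (j, true)),
    real_inner_comm w (b (j, false))]
  ring

lemma lt_of_fast {Z : Type*} [NormedAddCommGroup Z] [InnerProductSpace ℝ Z] [CompleteSpace Z]
    (b : ℕ × Bool → Z) (J : Z →L[ℝ] Z) (hJ : IsJ b J) (g : Z → ℝ) (hg : Differentiable ℝ g)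
    (m : ℝ) (hm : ∀ x, g x ≤ m) (n : ℕ) (z : ℝ → Z)
    (hz : ∀ t : ℝ, HasDerivAt z (J (proj b n (gradient g (z t)))) t)
    (hne : ∃ t₁ t₂ : ℝ, z t₁ ≠ z t₂) (t : ℝ) : g (z t) < m := by
  have hE : ∀ s : ℝ, HasDerivAt (fun s => g (z s)) 0 s := by
    intro s
    have h1 := ((hg (z s)).hasGradientAt.hasFDerivAt).comp_hasDerivAt s (hz s)
    have h2 := inner_J_proj b J hJ n (gradient g (z s))
    simp only [InnerProductSpace.toDual_apply_apply] at h1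
    rw [h2] at h1
    exact h1
  by_contra hlt
  have ht : g (z t) = m := le_antisymm (hm _) (not_lt.1 hlt)
  have hc : ∀ s, g (z s) = m := fun s => by
    rw [← ht]
    exact is_const_of_deriv_eq_zero (fun s => (hE s).differentiableAt) (fun s => (hE s).deriv) s t
  have hg0 : ∀ s, gradient g (z s) = 0 := by
    intro s
    have : IsLocalMax g (z s) := Filter.Eventually.of_forall fun x => by
      show g x ≤ g (z s)
      rw [hc s]; exact hm x
    have h0 := this.fderiv_eq_zero
    simp [gradient, h0]
  have hz0 : ∀ s, HasDerivAt z 0 s := by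
    intro s
    have := hz s
    rw [hg0 s] at this
    simpa [proj] using this
  obtain ⟨t₁, t₂, h12⟩ := hne
  exact h12 (is_const_of_deriv_eq_zero (fun s => (hz0 s).differentiableAt)
    (fun s => (hz0 s).deriv) t₁ t₂)

open Classical in
lemma capSet_sub {Z : Type*} [NormedAddCommGroup Z] [InnerProductSpace ℝ Z] [CompleteSpace Z]
    (b : ℕ × Bool → Z) (J : Z →L[ℝ] Z) (hb : IsHilbertBasis b) (hJ : IsJ b J)
    (O O' : Set Z) (hO' : IsOpen O') (ξ : Z) (hOO : ∀ x, x + ξ ∈ O' ↔ x ∈ O) :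
    capSet b J O ⊆ capSet b J O' := by
  rintro m' ⟨hm0, hm'⟩
  refine ⟨hm0, fun m f hmm hf => ?_⟩
  obtain ⟨hm, hfs, hfb, ⟨U, hU, hUne, hUO, hU0⟩, hfr, hbd, d, hd, hdist⟩ := hf
  have hclose : ∀ x ∈ {z ∈ O' | f z < m}, ∀ y, dist x y < d → y ∈ O' := fun x hx y hxy =>
    mem_of_close (A := {z ∈ O' | f z < m}) (fun _ h => h.1) hdist hx hxy
  obtain ⟨η, hη, hηd⟩ : ∃ η ∈ Submodule.span ℝ (Set.range b), dist ξ η < d := by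
    have : ξ ∈ closure (Submodule.span ℝ (Set.range b) : Set Z) := by
      rw [← Submodule.topologicalClosure_coe, hb.2]; trivial
    exact Metric.mem_closure_iff.1 this d hd
  obtain ⟨N, hN⟩ := proj_span b hb.1 η hη
  have hOf : ∀ x, x + ξ ∈ frontier O' ↔ x ∈ frontier O := by
    intro x
    have h1 : O = (Homeomorph.addRight ξ) ⁻¹' O' := by
      ext y; exact (hOO y).symm
    rw [h1, ← Homeomorph.preimage_frontier]
    rfl
  let F : Z → ℝ := fun x => if x ∈ O' then f x else m
  have hFin : ∀ x ∈ O', F x = f x := fun x hx => if_pos hx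
  have hFout : ∀ x, x ∉ O' → F x = m := fun x hx => if_neg hx
  have hFb : ∀ x, 0 ≤ F x ∧ F x ≤ m := by
    intro x
    by_cases hx : x ∈ O'
    · rw [hFin x hx]; exact hfb x hx
    · rw [hFout x hx]; exact ⟨hm.le, le_rfl⟩
  have hFlt : ∀ x, F x < m → x ∈ {z ∈ O' | f z < m} := by
    intro x hx
    by_cases hx' : x ∈ O'
    · rw [hFin x hx'] at hx; exact ⟨hx', hx⟩
    · rw [hFout x hx'] at hx; exact absurd hx (lt_irrefl _)
  have hFeq : ∀ x ∈ O', F =ᶠ[nhds x] f := fun x hx =>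
    Filter.eventually_of_mem (hO'.mem_nhds hx) hFin
  have hFs : ContDiff ℝ (⊤ : ℕ∞) F := by
    rw [contDiff_iff_contDiffAt]
    intro x
    by_cases hx : x ∈ O'
    · exact ((hfs x hx).contDiffAt (hO'.mem_nhds hx)).congr_of_eventuallyEq (hFeq x hx)
    · have : F =ᶠ[nhds x] fun _ => m := by
        refine Filter.eventually_of_mem (Metric.ball_mem_nhds x hd) fun y hy => ?_
        by_contra hne
        exact hx (hclose y (hFlt y (lt_of_le_of_ne (hFb y).2 hne)) x hy)
      exact contDiffAt_const.congr_of_eventuallyEq this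
  have hd1 : ∀ z : Z, dist (z + η) (z + ξ) = dist ξ η := fun z => by
    rw [dist_add_left, dist_comm]
  let g : Z → ℝ := fun z => F (z + η)
  have hgs : ContDiff ℝ (⊤ : ℕ∞) g := hFs.comp (contDiff_id.add contDiff_const)
  have hgO : ∀ z, g z < m → z ∈ O := fun z hz =>
    (hOO z).1 (hclose _ (hFlt _ hz) _ (by rw [hd1]; exact hηd))
  have hadm : IsAdmissible O m g := by
    refine ⟨hm, hgs.contDiffOn, fun z _ => hFb _, ?_, ?_, ?_, d - dist ξ η, by linarith, ?_⟩
    · have h0 : ∀ z ∈ (fun z => z + η) ⁻¹' U, g z = 0 := fun z hz => by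
        show F (z + η) = 0
        rw [hFin _ (hUO hz)]; exact hU0 _ hz
      refine ⟨(fun z => z + η) ⁻¹' U, hU.preimage (by fun_prop), ?_, ?_, h0⟩
      · obtain ⟨u, hu⟩ := hUne
        exact ⟨u - η, by simpa using hu⟩
      · intro z hz
        exact hgO z (by rw [h0 z hz]; exact hm)
    · intro z hz
      by_contra hne
      have h1 := hdist _ (hFlt (z + η) (lt_of_le_of_ne (hFb _).2 hne)) _ ((hOf z).2 hz)
      rw [hd1] at h1
      linarith
    · obtain ⟨R, hR⟩ := hbd.exists_norm_le
      refine isBounded_iff_forall_norm_le.2 ⟨R + ‖η‖, fun z hz => ?_⟩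
      have h1 := hR _ (hFlt (z + η) hz.2)
      have h2 := norm_sub_le (z + η) η
      rw [add_sub_cancel_right] at h2
      linarith
    · intro x hx y hy
      have h1 := hdist _ (hFlt (x + η) hx.2) _ ((hOf y).2 hy)
      have h2 := dist_triangle (x + η) (y + η) (y + ξ)
      rw [hd1, dist_add_right] at h2
      linarith
  obtain ⟨n₀, hn₀⟩ := hm' m g hmm hadm
  refine ⟨max n₀ N, fun n hn => ?_⟩
  obtain ⟨z, ⟨hz1, hz2, hz3⟩, hne, T, hT0, hT1, hT⟩ := hn₀ n (le_trans (le_max_left _ _) hn)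
  have hlt := lt_of_fast b J hJ g (hgs.differentiable (by simp)) m (fun x => (hFb _).2) n z hz3 hne
  have hmem : ∀ t, z t + η ∈ O' := fun t => (hFlt _ (hlt t)).1
  refine ⟨fun t => z t + η, ⟨hmem, fun t => ?_, fun t => ?_⟩, ?_, T, hT0, hT1, fun t => ?_⟩
  · rw [proj_add, hz2, hN n (le_trans (le_max_right _ _) hn)]
  · have hgr : gradient g (z t) = gradient f (z t + η) := by
      unfold gradient
      congr 1
      rw [← (hFeq _ (hmem t)).fderiv_eq]
      exact fderiv_comp_add_right (𝕜 := ℝ) (f := F) η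
    have := (hz3 t).add_const η
    rw [hgr] at this
    exact this
  · obtain ⟨t₁, t₂, h⟩ := hne
    exact ⟨t₁, t₂, fun h' => h (add_right_cancel h')⟩
  · show z (t + T) + η = z t + η
    rw [hT]

/-- Translation invariance of Kuksin's symplectic capacity:
`c(O + ξ) = c(O)` for every open `O ⊆ Z` and every `ξ ∈ Z`. -/
theorem cap_translate
    {Z : Type*} [NormedAddCommGroup Z] [InnerProductSpace ℝ Z] [CompleteSpace Z]
    (b : ℕ × Bool → Z) (J : Z →L[ℝ] Z) (hb : IsHilbertBasis b) (hJ : IsJ b J)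
    (O : Set Z) (hO : IsOpen O) (ξ : Z) :
    cap b J ((fun z : Z => z + ξ) '' O) = cap b J O := by
  have hmem := mem_tr O ξ
  have hO' : IsOpen ((fun z : Z => z + ξ) '' O) := (Homeomorph.addRight ξ).isOpenMap O hO
  have : capSet b J ((fun z : Z => z + ξ) '' O) = capSet b J O := by
    apply Set.Subset.antisymm
    · exact capSet_sub b J hb hJ _ O hO (-ξ) (fun x => by rw [hmem, sub_eq_add_neg])
    · exact capSet_sub b J hb hJ O _ hO' ξ (fun x => by rw [hmem, add_sub_cancel_right])
  unfold cap
  rw [this]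

end Kuksin
end
end
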